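/- arXiv:1405.4750 — 5 statements merged into one kernel-verified Lean document; each statement's English description precedes it below -/
import Mathlib

section
/- Let W : ℝ → ℝ be twice continuously differentiable, let μ ≥ 0 and γ > 0, and let u, v : (0,T) × ℝ → ℝ be four times continuously differentiable functions, 1-periodic in the space variable, satisfying ∂_t u = ∂_x v and ∂_t v = ∂_x(W′(u)) + μ ∂_x² v − γ ∂_x³ u on (0,T) × ℝ. Then the total energy E(t) := ∫₀¹ ( W(u(t,x)) + (γ/2)(∂_x u(t,x))² + ½ v(t,x)² ) dx is differentiable on (0,T) with E′(t) = − μ ∫₀¹ (∂_x v(t,x))² dx; in particular E is non-increasing. -/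
open Set

/-- Partial derivative in the first (time) variable. -/
noncomputable def pt (f : ℝ → ℝ → ℝ) (t x : ℝ) : ℝ := deriv (fun s => f s x) t

/-- Partial derivative in the second (space) variable. -/
noncomputable def px (f : ℝ → ℝ → ℝ) (t x : ℝ) : ℝ := deriv (fun y => f t y) x

/-- The total energy E(t) = ∫₀¹ W(u(t,x)) + (γ/2)(∂ₓu(t,x))² + ½ v(t,x)² dx. -/
noncomputable def totalEnergy (γ : ℝ) (W : ℝ → ℝ) (u v : ℝ → ℝ → ℝ) (t : ℝ) : ℝ :=
  ∫ y in (0 : ℝ)..1, (W (u t y) + γ / 2 * (px u t y) ^ 2 + (1 / 2) * (v t y) ^ 2)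


abbrev SS (T : ℝ) : Set (ℝ × ℝ) := Ioo 0 T ×ˢ (univ : Set ℝ)

lemma SS_open (T : ℝ) : IsOpen (SS T) := isOpen_Ioo.prod isOpen_univ

lemma SS_mem {T t : ℝ} (ht : t ∈ Ioo 0 T) (x : ℝ) : (t, x) ∈ SS T := ⟨ht, mem_univ _⟩

lemma hasD {T t : ℝ} {f : ℝ → ℝ → ℝ} {n : WithTop ℕ∞} (hn : n ≠ 0)
    (hf : ContDiffOn ℝ n (Function.uncurry f) (SS T)) (ht : t ∈ Ioo 0 T) (x : ℝ) :
    HasFDerivAt (Function.uncurry f) (fderiv ℝ (Function.uncurry f) (t, x)) (t, x) :=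
  ((hf.differentiableOn hn).differentiableAt ((SS_open T).mem_nhds (SS_mem ht x))).hasFDerivAt

lemma hasX0 {T t : ℝ} {f : ℝ → ℝ → ℝ} {n : WithTop ℕ∞} (hn : n ≠ 0)
    (hf : ContDiffOn ℝ n (Function.uncurry f) (SS T)) (ht : t ∈ Ioo 0 T) (x : ℝ) :
    HasDerivAt (fun y => f t y) (fderiv ℝ (Function.uncurry f) (t, x) (0, 1)) x := by
  have h := hasD hn hf ht x
  have h2 : HasDerivAt (fun y : ℝ => (t, y)) ((0 : ℝ), (1 : ℝ)) x :=
    (hasDerivAt_const x t).prodMk (hasDerivAt_id x)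
  exact h.comp_hasDerivAt x h2

lemma hasT0 {T t : ℝ} {f : ℝ → ℝ → ℝ} {n : WithTop ℕ∞} (hn : n ≠ 0)
    (hf : ContDiffOn ℝ n (Function.uncurry f) (SS T)) (ht : t ∈ Ioo 0 T) (x : ℝ) :
    HasDerivAt (fun s => f s x) (fderiv ℝ (Function.uncurry f) (t, x) (1, 0)) t := by
  have h := hasD hn hf ht x
  have h2 : HasDerivAt (fun y : ℝ => (y, x)) ((1 : ℝ), (0 : ℝ)) t :=
    (hasDerivAt_id t).prodMk (hasDerivAt_const t x)
  exact h.comp_hasDerivAt t h2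

lemma hasX {T t : ℝ} {f : ℝ → ℝ → ℝ} {n : WithTop ℕ∞} (hn : n ≠ 0)
    (hf : ContDiffOn ℝ n (Function.uncurry f) (SS T)) (ht : t ∈ Ioo 0 T) (x : ℝ) :
    HasDerivAt (fun y => f t y) (px f t x) x :=
  (hasX0 hn hf ht x).differentiableAt.hasDerivAt

lemma hasT {T t : ℝ} {f : ℝ → ℝ → ℝ} {n : WithTop ℕ∞} (hn : n ≠ 0)
    (hf : ContDiffOn ℝ n (Function.uncurry f) (SS T)) (ht : t ∈ Ioo 0 T) (x : ℝ) :
    HasDerivAt (fun s => f s x) (pt f t x) t :=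
  (hasT0 hn hf ht x).differentiableAt.hasDerivAt

lemma px_eq {T : ℝ} {f : ℝ → ℝ → ℝ} {n : WithTop ℕ∞} (hn : n ≠ 0)
    (hf : ContDiffOn ℝ n (Function.uncurry f) (SS T)) :
    EqOn (Function.uncurry (px f)) (fun p => fderiv ℝ (Function.uncurry f) p (0, 1)) (SS T) := by
  rintro ⟨t, x⟩ ⟨ht, -⟩
  exact (hasX0 hn hf ht x).deriv

lemma pt_eq {T : ℝ} {f : ℝ → ℝ → ℝ} {n : WithTop ℕ∞} (hn : n ≠ 0)
    (hf : ContDiffOn ℝ n (Function.uncurry f) (SS T)) :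
    EqOn (Function.uncurry (pt f)) (fun p => fderiv ℝ (Function.uncurry f) p (1, 0)) (SS T) := by
  rintro ⟨t, x⟩ ⟨ht, -⟩
  exact (hasT0 hn hf ht x).deriv

lemma px_cd {T : ℝ} {f : ℝ → ℝ → ℝ} {n m : WithTop ℕ∞} (hn : n ≠ 0) (hm : m + 1 ≤ n)
    (hf : ContDiffOn ℝ n (Function.uncurry f) (SS T)) :
    ContDiffOn ℝ m (Function.uncurry (px f)) (SS T) :=
  ((hf.fderiv_of_isOpen (SS_open T) hm).clm_apply contDiffOn_const).congr (px_eq hn hf)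

lemma pt_cd {T : ℝ} {f : ℝ → ℝ → ℝ} {n m : WithTop ℕ∞} (hn : n ≠ 0) (hm : m + 1 ≤ n)
    (hf : ContDiffOn ℝ n (Function.uncurry f) (SS T)) :
    ContDiffOn ℝ m (Function.uncurry (pt f)) (SS T) :=
  ((hf.fderiv_of_isOpen (SS_open T) hm).clm_apply contDiffOn_const).congr (pt_eq hn hf)

lemma pt_px {T t : ℝ} {f : ℝ → ℝ → ℝ}
    (hf : ContDiffOn ℝ 2 (Function.uncurry f) (SS T)) (ht : t ∈ Ioo 0 T) (x : ℝ) :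
    pt (px f) t x = px (pt f) t x := by
  have hS := (SS_open T).mem_nhds (SS_mem ht x)
  have hD : DifferentiableAt ℝ (fderiv ℝ (Function.uncurry f)) (t, x) :=
    ((hf.fderiv_of_isOpen (m := 1) (SS_open T) (by norm_num)).differentiableOn
      (by norm_num)).differentiableAt hS
  have h1 := pt_eq (n := 1) (by norm_num) (px_cd (n := 2) (by norm_num) (by norm_num) hf)
    (SS_mem ht x)
  have h2 := px_eq (n := 1) (by norm_num) (pt_cd (n := 2) (by norm_num) (by norm_num) hf)
    (SS_mem ht x)
  have e1 := ((px_eq (n := 2) (by norm_num) hf).eventuallyEq_of_mem hS).fderiv_eq (𝕜 := ℝ)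
  have e2 := ((pt_eq (n := 2) (by norm_num) hf).eventuallyEq_of_mem hS).fderiv_eq (𝕜 := ℝ)
  have g (w : ℝ × ℝ) : fderiv ℝ (fun p => fderiv ℝ (Function.uncurry f) p w) (t, x)
      = (fderiv ℝ (fderiv ℝ (Function.uncurry f)) (t, x)).flip w := by
    have := (hD.hasFDerivAt.clm_apply (hasFDerivAt_const w (t, x))).fderiv
    rw [this]; ext <;> simp
  have sy := (hf.contDiffAt hS).isSymmSndFDerivAt (by simp)
  simp only [Function.uncurry_apply_pair] at h1 h2
  rw [h1, h2, e1, e2, g, g]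
  exact sy _ _

lemma cont_slice {T t : ℝ} {f : ℝ → ℝ → ℝ}
    (hf : ContinuousOn (Function.uncurry f) (SS T)) (ht : t ∈ Ioo 0 T) :
    Continuous (fun y => f t y) :=
  hf.comp_continuous (f := fun y : ℝ => (t, y)) (by fun_prop) (fun y => SS_mem ht y)

lemma diff_int {T t : ℝ} {f : ℝ → ℝ → ℝ}
    (hf : ContDiffOn ℝ 1 (Function.uncurry f) (SS T)) (ht : t ∈ Ioo 0 T) :
    HasDerivAt (fun s => ∫ y in (0 : ℝ)..1, f s y) (∫ y in (0 : ℝ)..1, pt f t y) t := by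
  have hc : ContinuousOn (Function.uncurry (pt f)) (SS T) :=
    (pt_cd (m := 0) (n := 1) (by norm_num) (by norm_num) hf).continuousOn
  obtain ⟨ε, hε, hb⟩ := Metric.nhds_basis_closedBall.mem_iff.1 (isOpen_Ioo.mem_nhds ht)
  have hK : IsCompact (Metric.closedBall t ε ×ˢ Icc (0 : ℝ) 1) :=
    (isCompact_closedBall t ε).prod isCompact_Icc
  obtain ⟨C, hC⟩ := hK.exists_bound_of_continuousOn
    (hc.mono (prod_mono hb (subset_univ _)))
  refine (intervalIntegral.hasDerivAt_integral_of_dominated_loc_of_deriv_le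
    (bound := fun _ => C) (F := f) (F' := pt f) (Metric.closedBall_mem_nhds t hε) ?_ ?_ ?_ ?_ ?_ ?_).2
  · filter_upwards [isOpen_Ioo.mem_nhds ht] with s hs
    exact (cont_slice hf.continuousOn hs).aestronglyMeasurable
  · exact (cont_slice hf.continuousOn ht).intervalIntegrable _ _
  · exact (cont_slice hc ht).aestronglyMeasurable
  · refine Filter.Eventually.of_forall fun y hy s hs => ?_
    rw [uIoc_of_le zero_le_one] at hy
    exact hC (s, y) ⟨hs, Ioc_subset_Icc_self hy⟩
  · exact intervalIntegrable_const
  · exact Filter.Eventually.of_forall fun y _ s hs => hasT (n := 1) (by norm_num) hf (hb hs) y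

lemma px_per {f : ℝ → ℝ → ℝ} (h : ∀ t x : ℝ, f t (x + 1) = f t x) (t x : ℝ) :
    px f t (x + 1) = px f t x := by
  unfold px
  rw [← deriv_comp_add_const]
  simp only [h]

/-- Energy balance, Lemma "Energy balance for the regularized
system": if W ∈ C², μ ≥ 0, γ > 0 and u, v are C⁴ on (0,T) × ℝ, 1-periodic in
space, and satisfy ∂ₜu = ∂ₓv, ∂ₜv = ∂ₓ(W′(u)) + μ ∂ₓ²v − γ ∂ₓ³u there, then
E(t) = ∫₀¹ W(u) + (γ/2)(∂ₓu)² + ½ v² dx is differentiable on (0,T) with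
E′(t) = − μ ∫₀¹ (∂ₓ v(t,x))² dx; in particular E is non-increasing on (0,T). -/
theorem stmt_1 (T γ μ : ℝ) (hT : 0 < T) (hγ : 0 < γ) (hμ : 0 ≤ μ)
    (W : ℝ → ℝ) (hW : ContDiff ℝ 2 W)
    (u v : ℝ → ℝ → ℝ)
    (hu : ContDiffOn ℝ 4 (Function.uncurry u) (Ioo 0 T ×ˢ (univ : Set ℝ)))
    (hv : ContDiffOn ℝ 4 (Function.uncurry v) (Ioo 0 T ×ˢ (univ : Set ℝ)))
    (hperu : ∀ t x : ℝ, u t (x + 1) = u t x)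
    (hperv : ∀ t x : ℝ, v t (x + 1) = v t x)
    (heq1 : ∀ t ∈ Ioo (0 : ℝ) T, ∀ x : ℝ, pt u t x = px v t x)
    (heq2 : ∀ t ∈ Ioo (0 : ℝ) T, ∀ x : ℝ,
      pt v t x = px (fun s y => deriv W (u s y)) t x
        + μ * px (px v) t x - γ * px (px (px u)) t x) :
    (∀ t ∈ Ioo (0 : ℝ) T,
      HasDerivAt (totalEnergy γ W u v)
        (-(μ * ∫ y in (0 : ℝ)..1, (px v t y) ^ 2)) t) ∧
    AntitoneOn (totalEnergy γ W u v) (Ioo 0 T) := by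
  have hu' : ContDiffOn ℝ 4 (Function.uncurry u) (SS T) := hu
  have hv' : ContDiffOn ℝ 4 (Function.uncurry v) (SS T) := hv
  have n4 : (4 : WithTop ℕ∞) ≠ 0 := by norm_num
  have n3 : (3 : WithTop ℕ∞) ≠ 0 := by norm_num
  have n2 : (2 : WithTop ℕ∞) ≠ 0 := by norm_num
  have n1 : (1 : WithTop ℕ∞) ≠ 0 := by norm_num
  have a4 : (3 : WithTop ℕ∞) + 1 ≤ 4 := by norm_num
  have a3 : (2 : WithTop ℕ∞) + 1 ≤ 3 := by norm_num
  have a2 : (1 : WithTop ℕ∞) + 1 ≤ 2 := by norm_num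
  have a1 : (0 : WithTop ℕ∞) + 1 ≤ 1 := by norm_num
  have hux := px_cd n4 a4 hu'
  have huxx := px_cd n3 a3 hux
  have hvx := px_cd n4 a4 hv'
  have hvxx := px_cd n3 a3 hvx
  have hW1 : ContDiff ℝ 1 (deriv W) := ((contDiff_succ_iff_deriv (n := 1)).1 (by simpa [one_add_one_eq_two] using hW)).2.2
  have hWu : ContDiffOn ℝ 1 (Function.uncurry (fun s y => deriv W (u s y))) (SS T) :=
    hW1.comp_contDiffOn (hu'.of_le (by norm_num))
  have hE : ContDiffOn ℝ 1 (Function.uncurry (fun t y =>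
      W (u t y) + γ / 2 * (px u t y) ^ 2 + (1 / 2) * (v t y) ^ 2)) (SS T) := by
    have b1 : ContDiffOn ℝ 1 (fun p : ℝ × ℝ => W (u p.1 p.2)) (SS T) :=
      (hW.of_le (by norm_num)).comp_contDiffOn (hu'.of_le (by norm_num))
    have b2 : ContDiffOn ℝ 1 (fun p : ℝ × ℝ => px u p.1 p.2) (SS T) := hux.of_le (by norm_num)
    have b3 : ContDiffOn ℝ 1 (fun p : ℝ × ℝ => v p.1 p.2) (SS T) := hv'.of_le (by norm_num)
    exact (b1.add (contDiffOn_const.mul (b2.pow 2))).add (contDiffOn_const.mul (b3.pow 2))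
  have main : ∀ t ∈ Ioo (0 : ℝ) T,
      HasDerivAt (totalEnergy γ W u v)
        (-(μ * ∫ y in (0 : ℝ)..1, (px v t y) ^ 2)) t := by
    intro t ht
    have key := diff_int hE ht
    have hF : ∀ y : ℝ, HasDerivAt (fun y => deriv W (u t y) * v t y + γ * (px u t y * px v t y)
        + μ * (v t y * px v t y) - γ * (v t y * px (px u) t y))
        (pt (fun t y => W (u t y) + γ / 2 * (px u t y) ^ 2 + (1 / 2) * (v t y) ^ 2) t y
          + μ * (px v t y) ^ 2) y := by
      intro y
      have hW' : HasDerivAt W (deriv W (u t y)) (u t y) :=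
        ((hW.differentiable (by norm_num)) _).hasDerivAt
      have c1 := HasDerivAt.comp t hW' (hasT n4 hu' ht y)
      have c2 := (((hasT n3 hux ht y).pow 2).const_mul (γ / 2))
      have c3 := (((hasT n4 hv' ht y).pow 2).const_mul (1 / 2 : ℝ))
      have c : pt (fun t y => W (u t y) + γ / 2 * (px u t y) ^ 2 + (1 / 2) * (v t y) ^ 2) t y = _ :=
        ((c1.add c2).add c3).deriv
      have d1 : pt (px u) t y = px (px v) t y := by
        rw [pt_px (hu'.of_le (by norm_num)) ht y]
        unfold px
        congr 1
        funext z
        exact heq1 t ht z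
      have X1 := (hasX n1 hWu ht y).mul (hasX n4 hv' ht y)
      have X2 := ((hasX n3 hux ht y).mul (hasX n3 hvx ht y)).const_mul γ
      have X3 := ((hasX n4 hv' ht y).mul (hasX n3 hvx ht y)).const_mul μ
      have X4 := ((hasX n4 hv' ht y).mul (hasX n2 huxx ht y)).const_mul γ
      refine (((X1.add X2).add X3).sub X4).congr_deriv ?_
      rw [c, d1, heq1 t ht y, heq2 t ht y]
      push_cast
      ring
    have ci1 : Continuous (fun y =>
        pt (fun t y => W (u t y) + γ / 2 * (px u t y) ^ 2 + (1 / 2) * (v t y) ^ 2) t y) :=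
      cont_slice (pt_cd n1 a1 hE).continuousOn ht
    have ci2 : Continuous (fun y => px v t y) := cont_slice hvx.continuousOn ht
    have ci3 : Continuous (fun y => μ * (px v t y) ^ 2) := by fun_prop
    have hI := intervalIntegral.integral_eq_sub_of_hasDerivAt (a := 0) (b := 1) (fun y _ => hF y)
      ((ci1.add ci3).intervalIntegrable _ _)
    rw [intervalIntegral.integral_add (ci1.intervalIntegrable _ _) (ci3.intervalIntegrable _ _),
      intervalIntegral.integral_const_mul] at hI
    have p1 : u t 1 = u t 0 := by simpa using hperu t 0
    have p2 : v t 1 = v t 0 := by simpa using hperv t 0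
    have p3 : px u t 1 = px u t 0 := by simpa using px_per hperu t 0
    have p4 : px v t 1 = px v t 0 := by simpa using px_per hperv t 0
    have p5 : px (px u) t 1 = px (px u) t 0 := by simpa using px_per (px_per hperu) t 0
    rw [p1, p2, p3, p4, p5, sub_self] at hI
    exact key.congr_deriv (by linarith)
  refine ⟨main, antitoneOn_of_deriv_nonpos (convex_Ioo 0 T)
    (fun t ht => (main t ht).continuousAt.continuousWithinAt) ?_ ?_⟩
  · rw [interior_Ioo]
    exact fun t ht => (main t ht).differentiableAt.differentiableWithinAt
  · rw [interior_Ioo]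
    intro t ht
    rw [(main t ht).deriv]
    have : 0 ≤ ∫ y in (0 : ℝ)..1, (px v t y) ^ 2 :=
      intervalIntegral.integral_nonneg zero_le_one fun y _ => sq_nonneg _
    have := mul_nonneg hμ this
    linarith
end

section
/- With the dG setup below and assuming the mesh-ratio bound, there exists a constant C > 0 depending only on q and ρ (and not on the partition) such that for all Φ ∈ V_q: ‖G⁺[Φ]‖_{L²(0,1)} ≤ C ‖𝔥⁻¹ Φ‖_{L²(0,1)} and ‖G⁻[Φ]‖_{L²(0,1)} ≤ C ‖𝔥⁻¹ Φ‖_{L²(0,1)}, where 𝔥 : (0,1) → ℝ is the mesh-size function defined by 𝔥(x) = h_n for x ∈ (x_n, x_{n+1}). -/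
open scoped BigOperators
open MeasureTheory Set

namespace DG

noncomputable def pev (q : ℕ) (c : ℕ → ℕ → ℝ) (n : ℕ) (y : ℝ) : ℝ :=
  ∑ k ∈ Finset.range (q + 1), c n k * y ^ k

noncomputable def pev' (q : ℕ) (c : ℕ → ℕ → ℝ) (n : ℕ) (y : ℝ) : ℝ :=
  ∑ k ∈ Finset.range (q + 1), (k : ℝ) * c n k * y ^ (k - 1)

noncomputable def inner2 (q N : ℕ) (x : ℕ → ℝ) (c d : ℕ → ℕ → ℝ) : ℝ :=
  ∑ n ∈ Finset.range N, ∫ y in (x n)..(x (n + 1)), pev q c n y * pev q d n y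

noncomputable def nsq (q N : ℕ) (x : ℕ → ℝ) (c : ℕ → ℕ → ℝ) : ℝ :=
  inner2 q N x c c

noncomputable def intg (q N : ℕ) (x : ℕ → ℝ) (c : ℕ → ℕ → ℝ) : ℝ :=
  ∑ n ∈ Finset.range N, ∫ y in (x n)..(x (n + 1)), pev q c n y

noncomputable def valR (q : ℕ) (x : ℕ → ℝ) (c : ℕ → ℕ → ℝ) (n : ℕ) : ℝ :=
  pev q c n (x n)

noncomputable def valL (q N : ℕ) (x : ℕ → ℝ) (c : ℕ → ℕ → ℝ) (n : ℕ) : ℝ :=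
  if n = 0 then pev q c (N - 1) (x N) else pev q c (n - 1) (x n)

noncomputable def jmp (q N : ℕ) (x : ℕ → ℝ) (c : ℕ → ℕ → ℝ) (n : ℕ) : ℝ :=
  valL q N x c n - valR q x c n

noncomputable def Bm (q N : ℕ) (x : ℕ → ℝ) (w Ψ : ℕ → ℕ → ℝ) : ℝ :=
  (∑ n ∈ Finset.range N, ∫ y in (x n)..(x (n + 1)), pev' q w n y * pev q Ψ n y)
    - ∑ n ∈ Finset.range N, jmp q N x w n * valL q N x Ψ n

noncomputable def Bp (q N : ℕ) (x : ℕ → ℝ) (w Ψ : ℕ → ℕ → ℝ) : ℝ :=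
  (∑ n ∈ Finset.range N, ∫ y in (x n)..(x (n + 1)), pev' q w n y * pev q Ψ n y)
    - ∑ n ∈ Finset.range N, jmp q N x w n * valR q x Ψ n

def IsGminus (q N : ℕ) (x : ℕ → ℝ) (w g : ℕ → ℕ → ℝ) : Prop :=
  ∀ Ψ : ℕ → ℕ → ℝ, inner2 q N x g Ψ = Bm q N x w Ψ

def IsGplus (q N : ℕ) (x : ℕ → ℝ) (w g : ℕ → ℕ → ℝ) : Prop :=
  ∀ Ψ : ℕ → ℕ → ℝ, inner2 q N x g Ψ = Bp q N x w Ψ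

noncomputable def hseg (x : ℕ → ℝ) (n : ℕ) : ℝ := x (n + 1) - x n

noncomputable def hprev (N : ℕ) (x : ℕ → ℝ) (n : ℕ) : ℝ :=
  if n = 0 then hseg x (N - 1) else hseg x (n - 1)

noncomputable def dGsq (q N : ℕ) (x : ℕ → ℝ) (w : ℕ → ℕ → ℝ) : ℝ :=
  ∑ n ∈ Finset.range N,
    ((∫ y in (x n)..(x (n + 1)), (pev' q w n y) ^ 2)
      + 2 * (jmp q N x w n) ^ 2 / (hprev N x n + hseg x n))

def Partition (N : ℕ) (x : ℕ → ℝ) : Prop :=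
  2 ≤ N ∧ x 0 = 0 ∧ x N = 1 ∧ ∀ n < N, x n < x (n + 1)

def MeshRatio (N : ℕ) (x : ℕ → ℝ) (ρ : ℝ) : Prop :=
  ∀ n < N, hseg x n ≤ ρ * hseg x ((n + 1) % N) ∧ hseg x ((n + 1) % N) ≤ ρ * hseg x n

end DG

namespace DG


lemma ref0 (q : ℕ) : ∃ K > (0:ℝ), ∀ c : Fin (q+1) → ℝ,
    ‖c‖^2 ≤ K * ∫ t in (0:ℝ)..1, (∑ k : Fin (q+1), c k * t^(k:ℕ))^2 := by
  set F : (Fin (q+1) → ℝ) → ℝ := fun c => ∫ t in (0:ℝ)..1, (∑ k : Fin (q+1), c k * t^(k:ℕ))^2 with hF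
  have hcont : Continuous F := by
    apply intervalIntegral.continuous_parametric_intervalIntegral_of_continuous'
    simp only [Function.uncurry_def]
    fun_prop
  have hcomp : IsCompact (Metric.sphere (0 : Fin (q+1) → ℝ) 1) := isCompact_sphere _ _
  have hne : (Metric.sphere (0 : Fin (q+1) → ℝ) 1).Nonempty := by
    exact NormedSpace.sphere_nonempty.mpr zero_le_one
  obtain ⟨c0, hc0, hmin⟩ := hcomp.exists_isMinOn hne hcont.continuousOn
  have hc0n : ‖c0‖ = 1 := by simpa using hc0
  have hpos : 0 < F c0 := by
    by_contra hneg
    have hnn : ∀ t : ℝ, 0 ≤ (∑ k : Fin (q+1), c0 k * t^(k:ℕ))^2 := fun t => sq_nonneg _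
    have hcc : Continuous fun t : ℝ => (∑ k : Fin (q+1), c0 k * t^(k:ℕ))^2 := by fun_prop
    have hz : ∀ t ∈ Icc (0:ℝ) 1, ∑ k : Fin (q+1), c0 k * t^(k:ℕ) = 0 := by
      intro t ht
      by_contra h0
      apply hneg
      exact intervalIntegral.integral_pos zero_lt_one hcc.continuousOn (fun s _ => hnn s)
        ⟨t, ht, by positivity⟩
    set P : Polynomial ℝ := ∑ k : Fin (q+1), Polynomial.C (c0 k) * Polynomial.X^(k:ℕ) with hP
    have hP0 : P = 0 := by
      apply Polynomial.eq_zero_of_infinite_isRoot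
      apply (Set.Icc_infinite (zero_lt_one (α := ℝ))).mono
      intro t ht
      simpa [hP, Polynomial.eval_finsetSum] using hz t ht
    have : c0 = 0 := by
      ext k
      have := congrArg (fun p => Polynomial.coeff p (k:ℕ)) hP0
      simpa [hP, Polynomial.finsetSum_coeff, Polynomial.coeff_X_pow, Fin.val_inj] using this
    rw [this] at hc0n
    simp at hc0n
  refine ⟨1 / F c0, by positivity, fun c => ?_⟩
  change ‖c‖^2 ≤ 1 / F c0 * F c
  by_cases hc : c = 0
  · subst hc; simp [hF]
  have hcn : 0 < ‖c‖ := norm_pos_iff.mpr hc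
  have h1 : F c0 ≤ F (‖c‖⁻¹ • c) := hmin (by simp [norm_smul, hcn.ne'])
  have h2 : F (‖c‖⁻¹ • c) = (‖c‖⁻¹)^2 * F c := by
    simp only [hF]
    rw [← intervalIntegral.integral_const_mul]
    congr 1; ext t
    rw [← mul_pow, Finset.mul_sum]
    simp [mul_assoc]
  rw [h2] at h1
  rw [div_mul_eq_mul_div, le_div_iff₀ hpos, one_mul]
  have := mul_le_mul_of_nonneg_left h1 (sq_nonneg ‖c‖)
  rwa [← mul_assoc, ← mul_pow, mul_inv_cancel₀ hcn.ne', one_pow, one_mul] at this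

open Polynomial in
lemma ref1 (q : ℕ) : ∃ K > (0:ℝ), ∀ P : ℝ[X], P.natDegree ≤ q → ∀ t ∈ Icc (0:ℝ) 1,
    (P.eval t)^2 ≤ K * ∫ t in (0:ℝ)..1, (P.eval t)^2 ∧
    (P.derivative.eval t)^2 ≤ K * ∫ t in (0:ℝ)..1, (P.eval t)^2 := by
  obtain ⟨K, hK, h⟩ := ref0 q
  refine ⟨((q+1)^2)^2 * K, by positivity, fun P hP t ht => ?_⟩
  have h1 := h (fun k => P.coeff k)
  set c : Fin (q+1) → ℝ := fun k => P.coeff k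
  have e : ∀ t : ℝ, P.eval t = ∑ k : Fin (q+1), c k * t^(k:ℕ) := by
    intro t
    rw [eval_eq_sum_range' (Nat.lt_succ_of_le hP), Finset.sum_range]
  simp_rw [e]
  set I := ∫ t in (0:ℝ)..1, (∑ k : Fin (q+1), c k * t^(k:ℕ))^2
  have hp : ∀ k : ℕ, |t^k| ≤ 1 := fun k => by
    rw [abs_of_nonneg (pow_nonneg ht.1 _)]; exact pow_le_one₀ ht.1 ht.2
  have hc : ∀ k, |c k| ≤ ‖c‖ := fun k => norm_le_pi_norm c k
  have hq1 : (1:ℝ) ≤ q + 1 := by linarith [(Nat.cast_nonneg q : (0:ℝ) ≤ q)]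
  have fin : ∀ v : ℝ, |v| ≤ (q+1)^2 * ‖c‖ → v^2 ≤ ((q+1)^2)^2 * K * I := by
    intro v hv
    have := sq_le_sq' (by linarith [neg_abs_le v]) ((le_abs_self v).trans hv)
    rw [mul_pow] at this
    rw [mul_assoc]
    exact this.trans (mul_le_mul_of_nonneg_left h1 (by positivity))
  constructor
  · apply fin
    refine (Finset.abs_sum_le_sum_abs _ _).trans ?_
    refine (Finset.sum_le_sum (g := fun _ => ‖c‖) fun k _ => ?_).trans ?_
    · rw [abs_mul]
      nlinarith [hc k, hp k, abs_nonneg (c k)]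
    · simp
      have := norm_nonneg c
      nlinarith [mul_nonneg this (by linarith : (0:ℝ) ≤ q)]
  · apply fin
    rw [derivative_eval, Polynomial.sum_over_range' _ (by simp) (q+1) (Nat.lt_succ_of_le hP), Finset.sum_range]
    refine (Finset.abs_sum_le_sum_abs _ _).trans ?_
    refine (Finset.sum_le_sum (g := fun _ => ‖c‖ * (q+1)) fun k _ => ?_).trans ?_
    · rw [abs_mul, abs_mul, Nat.abs_cast]
      have hk : ((k:ℕ):ℝ) ≤ q + 1 := by exact_mod_cast k.2.le
      have := mul_le_mul (hc k) hk (Nat.cast_nonneg _) (norm_nonneg c)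
      refine le_trans ?_ this
      exact mul_le_of_le_one_right (by positivity) (hp _)
    · simp
      apply le_of_eq; ring

open Polynomial in
lemma ref2 (q : ℕ) : ∃ K > (0:ℝ), ∀ P : ℝ[X], P.natDegree ≤ q → ∀ a b : ℝ, a < b →
    (P.eval a)^2 ≤ K / (b-a) * ∫ t in a..b, (P.eval t)^2 ∧
    (P.eval b)^2 ≤ K / (b-a) * ∫ t in a..b, (P.eval t)^2 ∧
    (∫ t in a..b, (P.derivative.eval t)^2) ≤ K / (b-a)^2 * ∫ t in a..b, (P.eval t)^2 := by
  obtain ⟨K, hK, h⟩ := ref1 q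
  refine ⟨K, hK, fun P hP a b hab => ?_⟩
  have hh : 0 < b - a := by linarith
  set H := b - a with hH
  set Q := P.comp (C H * X + C a) with hQ
  have hQd : Q.natDegree ≤ q := by
    rw [hQ, natDegree_comp, natDegree_linear hh.ne']; simpa using hP
  have e : ∀ t, Q.eval t = P.eval (H * t + a) := by intro t; simp [hQ]
  have e' : ∀ t, Q.derivative.eval t = H * P.derivative.eval (H * t + a) := by
    intro t; simp [hQ, derivative_comp]
  have sc : ∀ f : ℝ → ℝ, ∫ t in a..b, f t = H * ∫ t in (0:ℝ)..1, f (H * t + a) := by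
    intro f
    rw [intervalIntegral.integral_comp_mul_add _ hh.ne']
    simp [hH, hh.ne']
    rw [← mul_assoc, mul_inv_cancel₀ (by simpa [hH] using hh.ne'), one_mul]
  have h0 := h Q hQd
  simp only [e, e'] at h0
  rw [sc (fun t => (P.eval t)^2), sc (fun t => (P.derivative.eval t)^2)]
  set I := ∫ t in (0:ℝ)..1, (P.eval (H * t + a))^2
  have eK : K / H * (H * I) = K * I := by field_simp
  rw [eK]
  refine ⟨?_, ?_, ?_⟩
  · simpa using (h0 0 (by simp)).1
  · have := (h0 1 (by simp)).1
    simpa [hH] using this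
  · have : ∫ t in (0:ℝ)..1, (P.derivative.eval (H*t+a))^2 ≤ ∫ t in (0:ℝ)..1, K / H^2 * I := by
      apply intervalIntegral.integral_mono_on zero_le_one
      · apply Continuous.intervalIntegrable; fun_prop
      · simp
      · intro t ht
        have := (h0 t ht).2
        rw [div_mul_eq_mul_div, le_div_iff₀ (by positivity)]
        linarith [mul_pow H (P.derivative.eval (H*t+a)) 2]
    simp at this
    calc _ ≤ H * (K / H^2 * I) := mul_le_mul_of_nonneg_left this hh.le
      _ = _ := by ring
end DG

namespace DG

open Polynomial in
lemma cell (q : ℕ) : ∃ K > (0:ℝ), ∀ (c : ℕ → ℕ → ℝ) (n : ℕ) (a b : ℝ), a < b →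
    (pev q c n a)^2 ≤ K / (b-a) * ∫ t in a..b, (pev q c n t)^2 ∧
    (pev q c n b)^2 ≤ K / (b-a) * ∫ t in a..b, (pev q c n t)^2 ∧
    (∫ t in a..b, (pev' q c n t)^2) ≤ K / (b-a)^2 * ∫ t in a..b, (pev q c n t)^2 := by
  obtain ⟨K, hK, h⟩ := ref2 q
  refine ⟨K, hK, fun c n a b hab => ?_⟩
  have := h (∑ k ∈ Finset.range (q+1), C (c n k) * X^k) ?_ a b hab
  · have e1 : ∀ t, (∑ k ∈ Finset.range (q+1), C (c n k) * X^k).eval t = pev q c n t := by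
      intro t; simp [eval_finsetSum, pev]
    have e2 : ∀ t, (derivative (∑ k ∈ Finset.range (q+1), C (c n k) * X^k)).eval t
        = pev' q c n t := by
      intro t
      simp only [derivative_sum, eval_finsetSum, pev']
      refine Finset.sum_congr rfl fun k _ => ?_
      simp [derivative_X_pow]; ring
    simpa only [e1, e2] using this
  · apply natDegree_sum_le_of_forall_le
    intro k hk
    exact (natDegree_C_mul_X_pow_le _ _).trans (Nat.lt_succ_iff.mp (Finset.mem_range.mp hk))

def prv (N n : ℕ) : ℕ := if n = 0 then N - 1 else n - 1

lemma sum_prv (N : ℕ) (hN : 2 ≤ N) (f : ℕ → ℝ) :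
    ∑ n ∈ Finset.range N, f (prv N n) = ∑ n ∈ Finset.range N, f n := by
  obtain ⟨M, rfl⟩ : ∃ M, N = M + 1 := ⟨N - 1, by omega⟩
  rw [Finset.sum_range_succ', Finset.sum_range_succ f]
  simp [prv]

lemma valL_eq (q N : ℕ) (hN : 2 ≤ N) (x : ℕ → ℝ) (c : ℕ → ℕ → ℝ) (n : ℕ) :
    valL q N x c n = pev q c (prv N n) (x (prv N n + 1)) := by
  unfold valL prv
  split_ifs
  · rw [Nat.sub_add_cancel (by omega)]
  · rw [Nat.sub_add_cancel (by omega)]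

lemma cont_pev (q : ℕ) (c : ℕ → ℕ → ℝ) (n : ℕ) : Continuous (pev q c n) := by
  unfold pev; fun_prop

lemma cont_pev' (q : ℕ) (c : ℕ → ℕ → ℝ) (n : ℕ) : Continuous (pev' q c n) := by
  unfold pev'; fun_prop

lemma key (K ρ j g h' h hp E Ep E' vl vr : ℝ) (hK : 0 < K)
    (hh' : 0 < h') (hh : 0 < h) (hhp : 0 < hp) (hE : 0 ≤ E) (hEp : 0 ≤ Ep)
    (hj : j = vl - vr) (h1 : vl^2 ≤ K / hp * Ep) (h2 : vr^2 ≤ K / h * E)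
    (h3 : g^2 ≤ K / h' * E') (r1 : h ≤ ρ * h') (r2 : hp ≤ ρ * h') :
    - (j * g) ≤ 2 * K^2 * ρ * (Ep / hp^2 + E / h^2) + 1/4 * E' := by
  have i1 : h' / (4*K) * g^2 ≤ 1/4 * E' := by
    calc h' / (4*K) * g^2 ≤ h' / (4*K) * (K / h' * E') := by gcongr
      _ = _ := by field_simp
  have i2 : -(j*g) ≤ K / h' * j^2 + h' / (4*K) * g^2 := by
    have : K / h' * j^2 + h' / (4*K) * g^2 + j * g = K / h' * (j + h' / (2*K) * g)^2 := by
      field_simp; ring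
    have : 0 ≤ K / h' * (j + h' / (2*K) * g)^2 := by positivity
    linarith
  have a1 : 1 / h' ≤ ρ / h := by rw [div_le_div_iff₀ hh' hh]; linarith
  have a2 : 1 / h' ≤ ρ / hp := by rw [div_le_div_iff₀ hh' hhp]; linarith
  have i3 : K / h' * j^2 ≤ 2 * K * (1/h' * vl^2 + 1/h' * vr^2) := by
    have : j^2 ≤ 2 * (vl^2 + vr^2) := by rw [hj]; nlinarith [sq_nonneg (vl+vr)]
    calc K / h' * j^2 ≤ K / h' * (2 * (vl^2 + vr^2)) := by gcongr
      _ = _ := by ring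
  have i4 : 1/h' * vl^2 ≤ ρ / hp * (K / hp * Ep) := by
    apply mul_le_mul a2 h1 (sq_nonneg _) (le_trans (by positivity) a2)
  have i5 : 1/h' * vr^2 ≤ ρ / h * (K / h * E) := by
    apply mul_le_mul a1 h2 (sq_nonneg _) (le_trans (by positivity) a1)
  have i6 : 2 * K * (1/h' * vl^2 + 1/h' * vr^2) ≤ 2 * K * (ρ / hp * (K / hp * Ep) + ρ / h * (K / h * E)) := by
    gcongr
  have i7 : 2 * K * (ρ / hp * (K / hp * Ep) + ρ / h * (K / h * E))
      = 2 * K^2 * ρ * (Ep / hp^2 + E / h^2) := by field_simp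
  linarith

lemma vol (a b : ℝ) (hab : a < b) (f g : ℝ → ℝ) (hf : Continuous f) (hg : Continuous g) :
    ∫ y in a..b, f y * g y ≤ (∫ y in a..b, (f y)^2) + 1/4 * ∫ y in a..b, (g y)^2 := by
  rw [← intervalIntegral.integral_const_mul, ← intervalIntegral.integral_add]
  · apply intervalIntegral.integral_mono_on hab.le
    · apply Continuous.intervalIntegrable; fun_prop
    · apply Continuous.intervalIntegrable; fun_prop
    · intro y _
      nlinarith [sq_nonneg (f y - 1/2 * g y)]
  · apply Continuous.intervalIntegrable; fun_prop
  · apply Continuous.intervalIntegrable; fun_prop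

lemma side (q N : ℕ) (x : ℕ → ℝ) (K ρ : ℝ) (hK : 0 < K)
    (hcell : ∀ (c : ℕ → ℕ → ℝ) (n : ℕ) (a b : ℝ), a < b →
    (pev q c n a)^2 ≤ K / (b-a) * ∫ t in a..b, (pev q c n t)^2 ∧
    (pev q c n b)^2 ≤ K / (b-a) * ∫ t in a..b, (pev q c n t)^2 ∧
    (∫ t in a..b, (pev' q c n t)^2) ≤ K / (b-a)^2 * ∫ t in a..b, (pev q c n t)^2)
    (hP : Partition N x) (Φ G : ℕ → ℕ → ℝ) (s : ℕ → ℕ) (v : ℕ → ℝ)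
    (hs : ∀ n < N, s n < N)
    (hsum : ∀ f : ℕ → ℝ, ∑ n ∈ Finset.range N, f (s n) = ∑ n ∈ Finset.range N, f n)
    (hv : ∀ n < N, (v n)^2 ≤ K / hseg x (s n) * ∫ y in (x (s n))..(x (s n + 1)), (pev q G (s n) y)^2)
    (r1 : ∀ n < N, hseg x n ≤ ρ * hseg x (s n))
    (r2 : ∀ n < N, hseg x (prv N n) ≤ ρ * hseg x (s n))
    (hG : inner2 q N x G G = (∑ n ∈ Finset.range N, ∫ y in (x n)..(x (n + 1)), pev' q Φ n y * pev q G n y)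
    - ∑ n ∈ Finset.range N, jmp q N x Φ n * v n) :
    nsq q N x G ≤ (2 * K + 8 * K^2 * ρ) * (∑ n ∈ Finset.range N,
            (∫ y in (x n)..(x (n + 1)), (pev q Φ n y) ^ 2) / (hseg x n) ^ 2) := by
  obtain ⟨hN, -, -, hlt⟩ := hP
  have hpos : ∀ n < N, 0 < hseg x n := fun n hn => sub_pos.mpr (hlt n hn)
  have hprv : ∀ n < N, prv N n < N := fun n hn => by unfold prv; split_ifs <;> omega
  set A : ℕ → ℝ := fun n => ∫ y in (x n)..(x (n + 1)), (pev q G n y)^2 with hA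
  set E : ℕ → ℝ := fun n => ∫ y in (x n)..(x (n + 1)), (pev q Φ n y)^2 with hE
  have hE0 : ∀ n < N, 0 ≤ E n := fun n hn =>
    intervalIntegral.integral_nonneg (hlt n hn).le fun y _ => sq_nonneg _
  have hns : nsq q N x G = ∑ n ∈ Finset.range N, A n := by
    simp only [nsq, inner2, hA, sq]
  have b1 : ∑ n ∈ Finset.range N, ∫ y in (x n)..(x (n + 1)), pev' q Φ n y * pev q G n y ≤
      ∑ n ∈ Finset.range N, (K * (E n / hseg x n ^2) + 1/4 * A n) := by
    refine Finset.sum_le_sum fun n hn => ?_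
    have hn := Finset.mem_range.mp hn
    have t1 := vol _ _ (hlt n hn) _ _ (cont_pev' q Φ n) (cont_pev q G n)
    have t2 := (hcell Φ n _ _ (hlt n hn)).2.2
    have t3 : K / (x (n+1) - x n)^2 * E n = K * (E n / hseg x n ^2) := by
      unfold hseg; ring
    simp only [hA]
    simp only [hE] at t3 ⊢
    linarith
  have b2 : ∑ n ∈ Finset.range N, -(jmp q N x Φ n * v n) ≤
      ∑ n ∈ Finset.range N, (2 * K^2 * ρ * (E (prv N n) / hseg x (prv N n)^2 + E n / hseg x n^2)
        + 1/4 * A (s n)) := by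
    refine Finset.sum_le_sum fun n hn => ?_
    have hn := Finset.mem_range.mp hn
    refine key K ρ _ _ (hseg x (s n)) _ _ _ _ _ (valL q N x Φ n) (valR q x Φ n) hK
      (hpos _ (hs n hn)) (hpos n hn) (hpos _ (hprv n hn)) (hE0 n hn) (hE0 _ (hprv n hn)) rfl
      ?_ ?_ (hv n hn) (r1 n hn) (r2 n hn)
    · rw [valL_eq q N hN]
      exact (hcell Φ _ _ _ (hlt _ (hprv n hn))).2.1
    · exact (hcell Φ n _ _ (hlt n hn)).1
  rw [Finset.sum_add_distrib, ← Finset.mul_sum, ← Finset.mul_sum] at b1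
  rw [Finset.sum_add_distrib, ← Finset.mul_sum, ← Finset.mul_sum, Finset.sum_add_distrib,
    hsum A, sum_prv N hN (fun n => E n / hseg x n^2), Finset.sum_neg_distrib] at b2
  have hG' : ∑ n ∈ Finset.range N, A n = _ := hns.symm.trans hG
  rw [hns]
  nlinarith
end DG

/-- Inverse-type stability of the discrete gradients,
Lemma "Properties of discrete gradients", first estimate in (eq:inverse-Gs):
under a mesh-ratio bound ρ there is C > 0 depending only on q and ρ with
‖G±[Φ]‖_{L²(0,1)} ≤ C ‖𝔥⁻¹ Φ‖_{L²(0,1)} for all Φ ∈ V_q, where 𝔥 is the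
mesh-size function.  Stated with squared norms; note
‖𝔥⁻¹Φ‖²_{L²} = ∑_n h_n⁻² ∫_{I_n} Φ².  Elements of V_q are represented by
cellwise polynomial coefficients. -/
theorem stmt_4 (q : ℕ) (hq : 1 ≤ q) (ρ : ℝ) (hρ : 1 ≤ ρ) :
    ∃ C > (0 : ℝ), ∀ (N : ℕ) (x : ℕ → ℝ), DG.Partition N x → DG.MeshRatio N x ρ →
      ∀ Φ Gp Gm : ℕ → ℕ → ℝ, DG.IsGplus q N x Φ Gp → DG.IsGminus q N x Φ Gm →
        DG.nsq q N x Gp ≤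
          C * (∑ n ∈ Finset.range N,
            (∫ y in (x n)..(x (n + 1)), (DG.pev q Φ n y) ^ 2) / (DG.hseg x n) ^ 2) ∧
        DG.nsq q N x Gm ≤
          C * (∑ n ∈ Finset.range N,
            (∫ y in (x n)..(x (n + 1)), (DG.pev q Φ n y) ^ 2) / (DG.hseg x n) ^ 2) := by
  obtain ⟨K, hK, hcell⟩ := DG.cell q
  refine ⟨2 * K + 8 * K^2 * ρ, by positivity, ?_⟩
  intro N x hP hM Φ Gp Gm hGp hGm
  have hN := hP.1
  have hpos : ∀ n < N, 0 < DG.hseg x n := fun n hn => sub_pos.mpr (hP.2.2.2 n hn)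
  have hprv : ∀ n < N, DG.prv N n < N := fun n hn => by unfold DG.prv; split_ifs <;> omega
  have hmod : ∀ n < N, (DG.prv N n + 1) % N = n := fun n hn => by
    unfold DG.prv
    split_ifs with h
    · rw [Nat.sub_add_cancel (by omega), Nat.mod_self, h]
    · rw [Nat.sub_add_cancel (by omega), Nat.mod_eq_of_lt hn]
  have hself : ∀ n < N, DG.hseg x n ≤ ρ * DG.hseg x n := fun n hn =>
    le_mul_of_one_le_left (hpos n hn).le hρ
  have hm : ∀ n < N, DG.hseg x (DG.prv N n) ≤ ρ * DG.hseg x n ∧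
      DG.hseg x n ≤ ρ * DG.hseg x (DG.prv N n) := fun n hn => by
    have := hM _ (hprv n hn)
    rwa [hmod n hn] at this
  constructor
  · refine DG.side q N x K ρ hK hcell hP Φ Gp id (DG.valR q x Gp) (fun n hn => hn)
      (fun f => rfl) (fun n hn => (hcell Gp n _ _ (hP.2.2.2 n hn)).1) hself
      (fun n hn => (hm n hn).1) (hGp Gp)
  · refine DG.side q N x K ρ hK hcell hP Φ Gm (DG.prv N) (DG.valL q N x Gm) hprv
      (DG.sum_prv N hN) (fun n hn => ?_) (fun n hn => (hm n hn).2)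
      (fun n hn => hself _ (hprv n hn)) (hGm Gm)
    rw [DG.valL_eq q N hN]
    exact (hcell Gm _ _ _ (hP.2.2.2 _ (hprv n hn))).2.1
end

section
/- Discrete Poincaré inequality: with the dG setup below, for every C₀ > 0 there exists a constant C > 0 depending only on q and C₀ (and not on the partition) such that, for every partition satisfying h · N ≤ C₀ and every Φ ∈ V_q with ∫₀¹ Φ dx = 0, one has ‖Φ‖_{L²(0,1)} ≤ C ‖G⁻[Φ]‖_{L²(0,1)}. -/
open scoped BigOperators
open MeasureTheory Set

namespace DGaux

theorem cont_pev (q : ℕ) (c : ℕ → ℕ → ℝ) (n : ℕ) : Continuous (DG.pev q c n) := by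
  unfold DG.pev; fun_prop

theorem cont_pev' (q : ℕ) (c : ℕ → ℕ → ℝ) (n : ℕ) : Continuous (DG.pev' q c n) := by
  unfold DG.pev'; fun_prop

theorem deriv_pev (q : ℕ) (c : ℕ → ℕ → ℝ) (n : ℕ) (y : ℝ) :
    HasDerivAt (DG.pev q c n) (DG.pev' q c n y) y := by
  have : HasDerivAt (fun y => ∑ k ∈ Finset.range (q + 1), c n k * y ^ k)
      (∑ k ∈ Finset.range (q + 1), c n k * ((k : ℝ) * y ^ (k - 1))) y := by
    apply HasDerivAt.fun_sum
    intro k _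
    exact (hasDerivAt_pow k y).const_mul (c n k)
  unfold DG.pev DG.pev'
  convert this using 1
  refine Finset.sum_congr rfl fun k _ => ?_
  ring

theorem cs {a b : ℝ} (hab : a < b) {f : ℝ → ℝ} (hf : Continuous f) :
    (∫ y in a..b, f y) ^ 2 ≤ (b - a) * ∫ y in a..b, f y ^ 2 := by
  have hh : 0 < b - a := sub_pos.2 hab
  set t := (∫ y in a..b, f y) / (b - a) with ht
  have h0 : 0 ≤ ∫ y in a..b, (f y - t) ^ 2 :=
    intervalIntegral.integral_nonneg hab.le fun y _ => sq_nonneg _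
  have h1 : ∫ y in a..b, (f y - t) ^ 2
      = (∫ y in a..b, f y ^ 2) - 2 * t * (∫ y in a..b, f y) + t ^ 2 * (b - a) := by
    have : ∀ y, (f y - t) ^ 2 = f y ^ 2 - 2 * t * f y + t ^ 2 := fun y => by ring
    simp_rw [this]
    rw [intervalIntegral.integral_add, intervalIntegral.integral_sub, intervalIntegral.integral_const_mul, intervalIntegral.integral_const]
    · simp; ring
    all_goals exact Continuous.intervalIntegrable (by fun_prop) _ _
  have h2 : (∫ y in a..b, f y) = t * (b - a) := by rw [ht]; field_simp
  rw [h1, h2] at h0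
  rw [h2]
  nlinarith

/-- weighted Hardy inequality on a cell -/
theorem hardy {a b : ℝ} (hab : a < b) {u u' : ℝ → ℝ} (hd : ∀ y, HasDerivAt u (u' y) y)
    (hu' : Continuous u') (h0 : u a = 0) :
    ∫ y in a..b, u y ^ 2 ≤ 4 * (b - a) * ∫ y in a..b, (b - y) * u' y ^ 2 := by
  have hh : 0 < b - a := sub_pos.2 hab
  have hu : Continuous u := continuous_iff_continuousAt.2 fun y => (hd y).continuousAt
  have e1 : ∫ y in a..b, (-(u y ^ 2) + (b - y) * (2 * u y * u' y)) = 0 := by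
    have hF : ∀ y ∈ uIcc a b, HasDerivAt (fun y => (b - y) * u y ^ 2)
        (-(u y ^ 2) + (b - y) * (2 * u y * u' y)) y := by
      intro y _
      have h1 : HasDerivAt (fun y => b - y) (-1) y := (hasDerivAt_id' y).const_sub b
      have h2 : HasDerivAt (fun y => u y ^ 2) (2 * u y * u' y) y := by
        have := (hd y).fun_pow 2
        simpa using this
      have h3 := h1.fun_mul h2
      have e : -(u y ^ 2) + (b - y) * (2 * u y * u' y)
        = -1 * u y ^ 2 + (b - y) * (2 * u y * u' y) := by ring
      rw [e]; exact h3
    rw [intervalIntegral.integral_eq_sub_of_hasDerivAt hF (Continuous.intervalIntegrable (by fun_prop) _ _)]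
    simp [h0]
  have e2 : ∫ y in a..b, u y ^ 2 / 2 - 2 * (b - a) * ((b - y) * u' y ^ 2) ≤
      ∫ y in a..b, -(-(u y ^ 2) + (b - y) * (2 * u y * u' y)) := by
    apply intervalIntegral.integral_mono_on hab.le
      (Continuous.intervalIntegrable (by fun_prop) _ _)
      (Continuous.intervalIntegrable (by fun_prop) _ _)
    intro y hy
    have hy1 : 0 ≤ b - y := sub_nonneg.2 hy.2
    have hy2 : 0 ≤ y - a := sub_nonneg.2 hy.1
    have hk : 2 * (b - a) * ((b - y) * (2 * u y * u' y)) ≤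
        2 * (b - a) * (u y ^ 2 / 2 + 2 * (b - a) * ((b - y) * u' y ^ 2)) := by
      nlinarith [mul_nonneg hy1 (sq_nonneg (u y - 2 * (b - a) * u' y)),
        mul_nonneg hy2 (sq_nonneg (u y))]
    have := le_of_mul_le_mul_left hk (by positivity)
    linarith
  rw [intervalIntegral.integral_neg, e1, intervalIntegral.integral_sub
    (Continuous.intervalIntegrable (by fun_prop) _ _)
    (Continuous.intervalIntegrable (by fun_prop) _ _), intervalIntegral.integral_const_mul, intervalIntegral.integral_div] at e2
  linarith

theorem cell {a b : ℝ} (hab : a < b) {p p' g : ℝ → ℝ} (hd : ∀ y, HasDerivAt p (p' y) y)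
    (hp' : Continuous p') (hg : Continuous g)
    (h : ∫ y in a..b, g y * ((b - y) * p' y) = ∫ y in a..b, p' y * ((b - y) * p' y)) :
    ∫ y in a..b, (p y - p a) ^ 2 ≤ 4 * (b - a) ^ 2 * ∫ y in a..b, g y ^ 2 := by
  have hh : 0 < b - a := sub_pos.2 hab
  have h1 := hardy hab (u := fun y => p y - p a) (fun y => (hd y).sub_const _) hp' (by simp)
  have h2 : ∫ y in a..b, 2 * (g y * ((b - y) * p' y)) - p' y * ((b - y) * p' y) ≤
      ∫ y in a..b, (b - a) * g y ^ 2 := by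
    apply intervalIntegral.integral_mono_on hab.le
      (Continuous.intervalIntegrable (by fun_prop) _ _)
      (Continuous.intervalIntegrable (by fun_prop) _ _)
    intro y hy
    have hy1 : 0 ≤ b - y := sub_nonneg.2 hy.2
    have hy2 : 0 ≤ y - a := sub_nonneg.2 hy.1
    nlinarith [mul_nonneg hy1 (sq_nonneg (g y - p' y)), mul_nonneg hy2 (sq_nonneg (g y))]
  rw [intervalIntegral.integral_sub
    (Continuous.intervalIntegrable (by fun_prop) _ _)
    (Continuous.intervalIntegrable (by fun_prop) _ _), intervalIntegral.integral_const_mul, intervalIntegral.integral_const_mul, h] at h2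
  have h3 : ∫ y in a..b, (b - y) * p' y ^ 2 = ∫ y in a..b, p' y * ((b - y) * p' y) := by
    congr 1; ext y; ring
  rw [h3] at h1
  calc _ ≤ _ := h1
    _ ≤ 4 * (b - a) * ((b - a) * ∫ y in a..b, g y ^ 2) := by
      apply mul_le_mul_of_nonneg_left _ (by positivity)
      linarith
    _ = _ := by ring

def pd (q : ℕ) (d : ℕ → ℝ) (y : ℝ) : ℝ := ∑ k ∈ Finset.range (q + 1), d k * y ^ k

theorem pev_loc (q m n : ℕ) (d : ℕ → ℝ) (y : ℝ) :
    DG.pev q (fun n k => if n = m then d k else 0) n y = if n = m then pd q d y else 0 := by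
  unfold DG.pev pd
  by_cases h : n = m <;> simp [h]

theorem loc (q N : ℕ) (x : ℕ → ℝ) (Φ G : ℕ → ℕ → ℝ) (h : DG.IsGminus q N x Φ G) (m : ℕ)
    (hm : m < N) (d : ℕ → ℝ) :
    ∫ y in (x m)..(x (m + 1)), DG.pev q G m y * pd q d y =
      (∫ y in (x m)..(x (m + 1)), DG.pev' q Φ m y * pd q d y)
        - DG.jmp q N x Φ (if m + 1 = N then 0 else m + 1) * pd q d (x (m + 1)) := by
  have := h (fun n k => if n = m then d k else 0)
  unfold DG.inner2 DG.Bm at this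
  rw [Finset.sum_eq_single m, Finset.sum_eq_single m,
    Finset.sum_eq_single (if m + 1 = N then 0 else m + 1)] at this
  · simp only [pev_loc, if_true] at this
    rw [this]
    congr 2
    unfold DG.valL
    by_cases hN : m + 1 = N
    · have : N - 1 = m := by omega
      simp [hN, this, pev_loc]
    · simp [hN, pev_loc]
  · intro n hn hne
    rw [Finset.mem_range] at hn
    unfold DG.valL
    by_cases hn0 : n = 0
    · have : N - 1 ≠ m := by
        rintro rfl
        apply hne
        rw [if_pos (by omega)]; exact hn0
      simp [hn0, pev_loc, this]
    · have : n - 1 ≠ m := by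
        rintro rfl
        apply hne
        rw [if_neg (by omega)]; omega
      simp [hn0, pev_loc, this]
  · intro hn
    exfalso; apply hn
    rw [Finset.mem_range]; split_ifs <;> omega
  · intro n _ hne
    simp [pev_loc, hne]
  · intro hn; exact absurd (Finset.mem_range.2 hm) hn
  · intro n _ hne
    simp [pev_loc, hne]
  · intro hn; exact absurd (Finset.mem_range.2 hm) hn

theorem pd_one (q : ℕ) (y : ℝ) : pd q (fun k => if k = 0 then 1 else 0) y = 1 := by
  unfold pd
  rw [Finset.sum_range_succ']
  simp

theorem pd_wt (q : ℕ) (c : ℕ → ℕ → ℝ) (n : ℕ) (b y : ℝ) :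
    pd q (fun j => (if j < q then b * ((j + 1 : ℕ) : ℝ) * c n (j + 1) else 0) - (j : ℝ) * c n j) y
      = (b - y) * DG.pev' q c n y := by
  unfold pd DG.pev'
  simp_rw [sub_mul, Finset.sum_sub_distrib]
  congr 1
  · rw [Finset.sum_range_succ, Finset.sum_range_succ' _ q]
    simp only [lt_irrefl, if_false, zero_mul, add_zero, Nat.cast_zero, Finset.mul_sum]
    refine Finset.sum_congr rfl fun k hk => ?_
    rw [if_pos (Finset.mem_range.1 hk)]
    simp only [Nat.add_sub_cancel]
    ring
  · rw [Finset.mul_sum]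
    refine Finset.sum_congr rfl fun k hk => ?_
    rcases k with _ | k
    · simp
    · simp only [Nat.add_sub_cancel]; ring

end DGaux

/-- Discrete Poincaré inequality, Lemma "Discrete Poincaré
inequality": for every C₀ > 0 there is C > 0 depending only on q and C₀ such
that for every partition with h·N ≤ C₀ and every mean-zero Φ ∈ V_q one has
‖Φ‖_{L²(0,1)} ≤ C ‖G⁻[Φ]‖_{L²(0,1)}.  Stated with squared norms.  Elements of
V_q are represented by cellwise polynomial coefficients. -/
theorem stmt_8 (q : ℕ) (hq : 1 ≤ q) (C₀ : ℝ) (hC₀ : 0 < C₀) :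
    ∃ C > (0 : ℝ), ∀ (N : ℕ) (x : ℕ → ℝ), DG.Partition N x →
      (∀ n < N, DG.hseg x n * (N : ℝ) ≤ C₀) →
      ∀ Φ Gm : ℕ → ℕ → ℝ, DG.intg q N x Φ = 0 → DG.IsGminus q N x Φ Gm →
        DG.nsq q N x Φ ≤ C * DG.nsq q N x Gm := by
  refine ⟨10, by norm_num, ?_⟩
  intro N x hP _ Φ G hint hG
  obtain ⟨hN, hx0, hxN, hlt⟩ := hP
  set E : ℕ → ℝ := fun n => ∫ y in (x n)..(x (n + 1)), DG.pev q G n y ^ 2 with hE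
  have hE0 : ∀ n < N, 0 ≤ E n := fun n hn =>
    intervalIntegral.integral_nonneg (hlt n hn).le fun y _ => sq_nonneg _
  have hEs : DG.nsq q N x G = ∑ n ∈ Finset.range N, E n := by
    unfold DG.nsq DG.inner2
    refine Finset.sum_congr rfl fun n _ => ?_
    simp only [hE, sq]
  have hS0 : 0 ≤ ∑ n ∈ Finset.range N, E n :=
    Finset.sum_nonneg fun n hn => hE0 n (Finset.mem_range.1 hn)
  set c := DG.pev q Φ 0 (x 0) with hc
  -- node increments
  have hstep : ∀ m, m + 1 < N → DG.pev q Φ (m + 1) (x (m + 1)) - DG.pev q Φ m (x m)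
      = ∫ y in (x m)..(x (m + 1)), DG.pev q G m y := by
    intro m hm
    have := DGaux.loc q N x Φ G hG m (by omega) (fun k => if k = 0 then 1 else 0)
    simp only [DGaux.pd_one, mul_one] at this
    rw [if_neg (by omega), intervalIntegral.integral_eq_sub_of_hasDerivAt
      (fun y _ => DGaux.deriv_pev q Φ m y) ((DGaux.cont_pev' q Φ m).intervalIntegrable _ _)] at this
    rw [this]
    simp [DG.jmp, DG.valL, DG.valR]
  have hxm : ∀ m, m ≤ N → 0 ≤ x m ∧ x m ≤ 1 := by
    intro m hm
    constructor
    · induction m with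
      | zero => exact hx0.ge
      | succ k ih => exact (ih (by omega)).trans (hlt k (by omega)).le
    · rw [← hxN]
      induction hm using Nat.decreasingInduction with
      | self => exact le_rfl
      | of_succ k hk ih => exact (hlt k hk).le.trans ih
  have htel : ∀ m, m < N → DG.pev q Φ m (x m) - c =
      ∑ n ∈ Finset.range m, ∫ y in (x n)..(x (n + 1)), DG.pev q G n y := by
    intro m
    induction m with
    | zero => intro _; simp [hc]
    | succ k ih =>
      intro hk
      rw [Finset.sum_range_succ, ← ih (by omega), ← hstep k hk]; ring
  have hnode : ∀ m, m < N → (DG.pev q Φ m (x m) - c) ^ 2 ≤ ∑ n ∈ Finset.range N, E n := by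
    intro m hm
    rw [htel m hm]
    have h1 := Finset.sum_sq_le_sum_mul_sum_of_sq_le_mul (Finset.range m)
      (r := fun n => ∫ y in (x n)..(x (n + 1)), DG.pev q G n y)
      (f := fun n => x (n + 1) - x n) (g := E)
      (fun n hn => sub_nonneg.2 (hlt n ((Finset.mem_range.1 hn).trans hm)).le)
      (fun n hn => hE0 n ((Finset.mem_range.1 hn).trans hm))
      (fun n hn => DGaux.cs (hlt n ((Finset.mem_range.1 hn).trans hm)) (DGaux.cont_pev q G n))
    rw [Finset.sum_range_sub, hx0, sub_zero] at h1
    have h2 : ∑ n ∈ Finset.range m, E n ≤ ∑ n ∈ Finset.range N, E n :=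
      Finset.sum_le_sum_of_subset_of_nonneg (Finset.range_mono hm.le)
        fun n hn _ => hE0 n (Finset.mem_range.1 hn)
    have h3 : 0 ≤ ∑ n ∈ Finset.range m, E n :=
      Finset.sum_nonneg fun n hn => hE0 n ((Finset.mem_range.1 hn).trans hm)
    have h4 := hxm m hm.le
    nlinarith
  have hcell : ∀ m, m < N →
      ∫ y in (x m)..(x (m + 1)), (DG.pev q Φ m y - DG.pev q Φ m (x m)) ^ 2 ≤ 4 * E m := by
    intro m hm
    have h1 := DGaux.loc q N x Φ G hG m hm (fun j =>
      (if j < q then x (m + 1) * ((j + 1 : ℕ) : ℝ) * Φ m (j + 1) else 0) - (j : ℝ) * Φ m j)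
    simp only [DGaux.pd_wt, sub_self, zero_mul, mul_zero, sub_zero] at h1
    have h2 := DGaux.cell (hlt m hm) (DGaux.deriv_pev q Φ m) (DGaux.cont_pev' q Φ m)
      (DGaux.cont_pev q G m) h1
    refine h2.trans ?_
    have h3 := hE0 m hm
    have h4 : (x (m + 1) - x m) ^ 2 ≤ 1 := by
      have := hxm m hm.le
      have := hxm (m + 1) hm
      have := hlt m hm
      nlinarith
    change 4 * _ * E m ≤ _
    nlinarith
  have hcell2 : ∀ m ∈ Finset.range N,
      (∫ y in (x m)..(x (m + 1)), DG.pev q Φ m y * DG.pev q Φ m y)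
        - 2 * c * (∫ y in (x m)..(x (m + 1)), DG.pev q Φ m y) + c ^ 2 * (x (m + 1) - x m)
      ≤ 8 * E m + 2 * (∑ n ∈ Finset.range N, E n) * (x (m + 1) - x m) := by
    intro m hm
    rw [Finset.mem_range] at hm
    have hcp := DGaux.cont_pev q Φ m
    set p := DG.pev q Φ m with hp
    have e1 : (∫ y in (x m)..(x (m + 1)), p y * p y)
        - 2 * c * (∫ y in (x m)..(x (m + 1)), p y) + c ^ 2 * (x (m + 1) - x m)
        = ∫ y in (x m)..(x (m + 1)), (p y - c) ^ 2 := by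
      have : ∀ y, (p y - c) ^ 2 = p y * p y - 2 * c * p y + c ^ 2 := fun y => by ring
      simp_rw [this]
      rw [intervalIntegral.integral_add, intervalIntegral.integral_sub,
        intervalIntegral.integral_const_mul, intervalIntegral.integral_const]
      · simp; ring
      all_goals exact Continuous.intervalIntegrable (by fun_prop) _ _
    have e2 : ∫ y in (x m)..(x (m + 1)), (p y - c) ^ 2 ≤
        ∫ y in (x m)..(x (m + 1)), 2 * (p y - p (x m)) ^ 2 + 2 * (p (x m) - c) ^ 2 := by
      apply intervalIntegral.integral_mono_on (hlt m hm).le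
        (Continuous.intervalIntegrable (by fun_prop) _ _)
        (Continuous.intervalIntegrable (by fun_prop) _ _)
      intro y _
      nlinarith [sq_nonneg (p y - p (x m) - (p (x m) - c))]
    rw [intervalIntegral.integral_add
      (Continuous.intervalIntegrable (by fun_prop) _ _)
      (Continuous.intervalIntegrable (by fun_prop) _ _),
      intervalIntegral.integral_const_mul, intervalIntegral.integral_const, smul_eq_mul] at e2
    rw [e1]
    have e3 := hcell m hm
    have e4 := mul_le_mul_of_nonneg_left (hnode m hm) (sub_nonneg.2 (hlt m hm).le)
    linarith
  have hfin := Finset.sum_le_sum hcell2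
  rw [Finset.sum_add_distrib, Finset.sum_sub_distrib, Finset.sum_add_distrib, ← Finset.mul_sum,
    ← Finset.mul_sum, ← Finset.mul_sum, ← Finset.mul_sum, Finset.sum_range_sub, hx0, hxN] at hfin
  unfold DG.intg at hint
  rw [hint] at hfin
  rw [hEs]
  unfold DG.nsq DG.inner2
  nlinarith [sq_nonneg c]
end

section
/- Coercivity of G⁻: with the dG setup below, there exists a constant C > 0 depending only on q (and not on the partition) such that |w|_dG ≤ C ‖G⁻[w]‖_{L²(0,1)} for every w ∈ V_q. -/
open scoped BigOperators
open MeasureTheory Set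

open Polynomial in
lemma normeq01 (q : ℕ) : ∃ K > (0 : ℝ), ∀ p : Polynomial ℝ, p.natDegree ≤ q →
    ∫ t in (0:ℝ)..1, (p.eval t) ^ 2 ≤ K * ∫ t in (0:ℝ)..1, (1 - t) * (p.eval t) ^ 2 := by
  set f : (Fin (q+1) → ℝ) → ℝ → ℝ := fun c t => ∑ k : Fin (q+1), c k * t ^ (k : ℕ) with hf
  have hfc : Continuous (Function.uncurry f) := by
    simp only [hf, Function.uncurry_def]; fun_prop
  have hfc1 : ∀ c, Continuous (f c) := fun c => by simp only [hf]; fun_prop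
  have hsm : ∀ (r : ℝ) c t, f (r • c) t = r * f c t := by
    intro r c t; simp [hf, Finset.mul_sum, mul_assoc]
  set A : (Fin (q+1) → ℝ) → ℝ := fun c => ∫ t in (0:ℝ)..1, (f c t) ^ 2 with hA
  set B : (Fin (q+1) → ℝ) → ℝ := fun c => ∫ t in (0:ℝ)..1, (1 - t) * (f c t) ^ 2 with hB
  have hAc : Continuous A := by
    apply intervalIntegral.continuous_parametric_intervalIntegral_of_continuous'
    simp only [Function.uncurry_def] at hfc ⊢; fun_prop
  have hBc : Continuous B := by
    apply intervalIntegral.continuous_parametric_intervalIntegral_of_continuous'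
    simp only [Function.uncurry_def] at hfc ⊢; fun_prop
  have hA0 : ∀ c, 0 ≤ A c := fun c =>
    intervalIntegral.integral_nonneg (by norm_num) (fun t _ => sq_nonneg _)
  have hBpos : ∀ c, c ≠ 0 → 0 < B c := by
    intro c hc
    have hex : ∃ t ∈ Set.Ioo (0:ℝ) 1, f c t ≠ 0 := by
      by_contra! hcon
      apply hc
      set P : ℝ[X] := ∑ k : Fin (q+1), C (c k) * X ^ (k:ℕ) with hP
      have hP0 : P = 0 := by
        apply Polynomial.eq_zero_of_infinite_isRoot
        apply (Set.Ioo_infinite (zero_lt_one (α := ℝ))).mono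
        intro t ht
        have := hcon t ht
        simpa [hP, IsRoot, eval_finsetSum, hf] using this
      funext k
      have h2 : P.coeff (k:ℕ) = c k := by
        simp [hP, coeff_C_mul, coeff_X_pow, Fin.val_inj]
      rw [← h2, hP0]; simp
    obtain ⟨t, ht, hft⟩ := hex
    have := hfc1 c
    apply intervalIntegral.integral_pos (by norm_num)
    · fun_prop
    · intro s hs
      exact mul_nonneg (by linarith [hs.2]) (sq_nonneg _)
    · exact ⟨t, Set.Ioo_subset_Icc_self ht, mul_pos (by linarith [ht.2]) (by positivity)⟩
  have hcpt : IsCompact (Metric.sphere (0 : Fin (q+1) → ℝ) 1) := isCompact_sphere _ _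
  have hquot : ContinuousOn (fun c => A c / B c) (Metric.sphere (0 : Fin (q+1) → ℝ) 1) := by
    apply ContinuousOn.div hAc.continuousOn hBc.continuousOn
    intro c hc
    refine (hBpos c ?_).ne'
    rintro rfl; simp at hc
  obtain ⟨K, hK⟩ := hcpt.bddAbove_image hquot
  refine ⟨max K 1, by positivity, fun p hp => ?_⟩
  set c : Fin (q+1) → ℝ := fun k => p.coeff k with hcdef
  have hpe : ∀ t, p.eval t = f c t := by
    intro t
    rw [eval_eq_sum_range' (Nat.lt_succ_of_le hp), Finset.sum_range]
  simp only [hpe]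
  change A c ≤ _ * B c
  by_cases hc : c = 0
  · have : ∀ t, f c t = 0 := by intro t; simp [hf, hc]
    simp [hA, hB, this]
  · have hn : 0 < ‖c‖ := norm_pos_iff.mpr hc
    set d := ‖c‖⁻¹ • c with hd
    have hcd : c = ‖c‖ • d := by rw [hd, smul_smul, mul_inv_cancel₀ hn.ne', one_smul]
    have hds : d ∈ Metric.sphere (0 : Fin (q+1) → ℝ) 1 := by
      simp [hd, norm_smul, hn.ne']
    have hdn : d ≠ 0 := by rintro h; rw [h] at hds; simp at hds
    have h1 : A d / B d ≤ K := hK ⟨d, hds, rfl⟩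
    have h2 : A d ≤ max K 1 * B d := by
      rw [← div_le_iff₀ (hBpos d hdn)]; exact h1.trans (le_max_left _ _)
    have hAe : A c = ‖c‖^2 * A d := by
      conv_lhs => rw [hcd]
      simp only [hA, hsm, mul_pow, intervalIntegral.integral_const_mul]
    have hBe : B c = ‖c‖^2 * B d := by
      conv_lhs => rw [hcd]
      simp only [hB]
      rw [← intervalIntegral.integral_const_mul]
      apply intervalIntegral.integral_congr
      intro t _
      simp only [hsm]; ring
    rw [hAe, hBe]
    nlinarith [sq_nonneg ‖c‖]

open Polynomial in
lemma normeq (q : ℕ) : ∃ K > (0 : ℝ), ∀ a b : ℝ, a < b → ∀ p : Polynomial ℝ, p.natDegree ≤ q →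
    (b - a) * ∫ t in a..b, (p.eval t) ^ 2 ≤ K * ∫ t in a..b, (b - t) * (p.eval t) ^ 2 := by
  obtain ⟨K, hK, h⟩ := normeq01 q
  refine ⟨K, hK, fun a b hab p hp => ?_⟩
  have hd : 0 < b - a := by linarith
  have h1 := h (p.comp (C (b - a) * X + C a)) (by
    refine natDegree_comp_le.trans ?_
    calc _ ≤ p.natDegree * 1 := Nat.mul_le_mul_left _ natDegree_linear_le
      _ ≤ q := by simpa using hp)
  have e1 : ∫ t in a..b, (p.eval t) ^ 2 =
      (b - a) * ∫ t in (0:ℝ)..1, ((p.comp (C (b - a) * X + C a)).eval t) ^ 2 := by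
    have := intervalIntegral.mul_integral_comp_mul_add (a := 0) (b := 1)
      (f := fun t => (p.eval t) ^ 2) (b - a) a
    simp only [mul_zero, zero_add, mul_one, sub_add_cancel] at this
    rw [← this]; simp
  have e2 : ∫ t in a..b, (b - t) * (p.eval t) ^ 2 =
      (b - a)^2 * ∫ t in (0:ℝ)..1, (1 - t) * ((p.comp (C (b - a) * X + C a)).eval t) ^ 2 := by
    have := intervalIntegral.mul_integral_comp_mul_add (a := 0) (b := 1)
      (f := fun t => (b - t) * (p.eval t) ^ 2) (b - a) a
    simp only [mul_zero, zero_add, mul_one, sub_add_cancel] at this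
    rw [← this, sq, mul_assoc]
    congr 1
    rw [← intervalIntegral.integral_const_mul (b-a)]
    apply intervalIntegral.integral_congr
    intro t _
    simp; ring
  rw [e1, e2]
  nlinarith [mul_le_mul_of_nonneg_left h1 (sq_nonneg (b-a))]

open Polynomial in
lemma local_bd (q : ℕ) (hq : 1 ≤ q) : ∃ C > (0 : ℝ), ∀ a b : ℝ, a < b →
    ∀ (g w : Polynomial ℝ) (J : ℝ), w.natDegree + 1 ≤ q →
    (∀ p : Polynomial ℝ, p.natDegree ≤ q → ∫ y in a..b, g.eval y * p.eval y =
      (∫ y in a..b, w.eval y * p.eval y) - J * p.eval b) →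
    (∫ y in a..b, (w.eval y)^2) + 2 * J^2 / (b - a) ≤ C * ∫ y in a..b, g.eval y * g.eval y := by
  obtain ⟨K, hK, h⟩ := normeq q
  refine ⟨5 * K + 4, by positivity, fun a b hab g w J hw H => ?_⟩
  have hd : 0 < b - a := by linarith
  have I : ∀ f : ℝ → ℝ, Continuous f → IntervalIntegrable f volume a b :=
    fun f hf => hf.intervalIntegrable a b
  have cg : Continuous fun y => g.eval y := g.continuous
  have cw : Continuous fun y => w.eval y := w.continuous
  have h1 := h a b hab w (by omega)
  have h2 := H ((C b - X) * w) (by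
    refine natDegree_mul_le.trans ?_
    have : (C b - X : ℝ[X]).natDegree ≤ 1 := by
      refine (natDegree_sub_le _ _).trans ?_
      simp
    omega)
  have h3 := H 1 (by simp)
  simp only [eval_mul, eval_sub, eval_C, eval_X, sub_self, zero_mul, mul_zero, sub_zero, eval_one, mul_one] at h2 h3
  set G := ∫ y in a..b, g.eval y * g.eval y with hG
  set W := ∫ y in a..b, (w.eval y)^2 with hW
  set S := ∫ y in a..b, (b - y) * (w.eval y)^2 with hS
  have h4 : S ≤ (b - a) * G := by
    have e : S = 2 * (∫ y in a..b, g.eval y * ((b - y) * w.eval y)) - S := by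
      rw [h2]
      have : ∫ y in a..b, w.eval y * ((b - y) * w.eval y) = S :=
        intervalIntegral.integral_congr (fun y _ => by ring)
      rw [this]; ring
    rw [e, ← intervalIntegral.integral_const_mul, ← intervalIntegral.integral_sub (I _ (by fun_prop)) (I _ (by fun_prop)), hG, ← intervalIntegral.integral_const_mul]
    apply intervalIntegral.integral_mono_on hab.le (I _ (by fun_prop)) (I _ (by fun_prop))
    intro y hy
    have : 0 ≤ (b - y) * (g.eval y - w.eval y)^2 := mul_nonneg (by linarith [hy.2]) (sq_nonneg _)
    have : 0 ≤ (y - a) * (g.eval y)^2 := mul_nonneg (by linarith [hy.1]) (sq_nonneg _)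
    nlinarith
  have h5 : W ≤ K * G := by
    have : (b - a) * W ≤ (b - a) * (K * G) := by nlinarith
    exact le_of_mul_le_mul_left this hd
  have hJ : J = ∫ y in a..b, (w.eval y - g.eval y) := by
    rw [intervalIntegral.integral_sub (I _ cw) (I _ cg), h3]; ring
  have h6 : 0 ≤ ∫ y in a..b, ((w.eval y - g.eval y) - J / (b-a))^2 :=
    intervalIntegral.integral_nonneg hab.le (fun y _ => sq_nonneg _)
  have h7 : ∫ y in a..b, ((w.eval y - g.eval y) - J / (b-a))^2 =
      (∫ y in a..b, (w.eval y - g.eval y)^2) - J^2/(b-a) := by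
    have : ∀ y, ((w.eval y - g.eval y) - J / (b-a))^2 =
      (w.eval y - g.eval y)^2 - 2 * (J/(b-a)) * (w.eval y - g.eval y) + (J/(b-a))^2 := fun y => by ring
    simp only [this]
    rw [intervalIntegral.integral_add (I _ (by fun_prop)) (I _ (by fun_prop)),
      intervalIntegral.integral_sub (I _ (by fun_prop)) (I _ (by fun_prop)),
      intervalIntegral.integral_const_mul, ← hJ, intervalIntegral.integral_const, smul_eq_mul]
    field_simp; ring
  have h8 : ∫ y in a..b, (w.eval y - g.eval y)^2 ≤ 2 * W + 2 * G := by
    rw [hW, hG, ← intervalIntegral.integral_const_mul, ← intervalIntegral.integral_const_mul,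
      ← intervalIntegral.integral_add (I _ (by fun_prop)) (I _ (by fun_prop))]
    apply intervalIntegral.integral_mono_on hab.le (I _ (by fun_prop)) (I _ (by fun_prop))
    intro y _
    nlinarith [sq_nonneg (w.eval y + g.eval y)]
  have h9 : 2 * J^2 / (b-a) = 2 * (J^2/(b-a)) := by ring
  rw [h9]; linarith

lemma reindex (N : ℕ) (hN : 1 ≤ N) (F : ℕ → ℕ → ℝ) :
    ∑ m ∈ Finset.range N, F m (if m = 0 then N - 1 else m - 1) =
      ∑ n ∈ Finset.range N, F (if n + 1 = N then 0 else n + 1) n := by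
  obtain ⟨M, rfl⟩ : ∃ M, N = M + 1 := ⟨N - 1, by omega⟩
  rw [Finset.sum_range_succ', Finset.sum_range_succ]
  congr 1
  · apply Finset.sum_congr rfl
    intro n hn
    have := Finset.mem_range.mp hn
    rw [if_neg (by omega), if_neg (by omega)]; simp
  · simp

namespace DG

noncomputable def toP (q : ℕ) (c : ℕ → ℕ → ℝ) (n : ℕ) : Polynomial ℝ :=
  ∑ k ∈ Finset.range (q + 1), Polynomial.C (c n k) * Polynomial.X ^ k

lemma pev_eq (q c n y) : pev q c n y = (toP q c n).eval y := by
  simp [pev, toP, Polynomial.eval_finsetSum]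

lemma pev'_eq (q c n y) : pev' q c n y = (toP q c n).derivative.eval y := by
  simp only [pev', toP, Polynomial.derivative_sum, Polynomial.eval_finsetSum]
  apply Finset.sum_congr rfl
  intro k _
  simp [Polynomial.derivative_X_pow]; ring

lemma toP_deg (q c n) : (toP q c n).natDegree ≤ q := by
  apply Polynomial.natDegree_sum_le_of_forall_le
  intro k hk
  have := Finset.mem_range.mp hk
  exact (Polynomial.natDegree_C_mul_X_pow_le _ _).trans (by omega)

end DG

theorem stmt_9 (q : ℕ) (hq : 1 ≤ q) :
    ∃ C > (0 : ℝ), ∀ (N : ℕ) (x : ℕ → ℝ), DG.Partition N x →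
      ∀ w Gm : ℕ → ℕ → ℝ, DG.IsGminus q N x w Gm →
        DG.dGsq q N x w ≤ C * DG.nsq q N x Gm := by
  obtain ⟨C, hC, h⟩ := local_bd q hq
  refine ⟨C, hC, fun N x hx w Gm hG => ?_⟩
  obtain ⟨hN, -, -, hlt⟩ := hx
  have hN1 : 1 ≤ N := by omega
  have hvalL : ∀ c m, DG.valL q N x c m =
      DG.pev q c (if m = 0 then N - 1 else m - 1) (x ((if m = 0 then N - 1 else m - 1) + 1)) := by
    intro c m
    unfold DG.valL
    split_ifs with hm
    · rw [Nat.sub_add_cancel hN1]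
    · rw [Nat.sub_add_cancel (by omega)]
  have hprev : ∀ m, DG.hprev N x m = DG.hseg x (if m = 0 then N - 1 else m - 1) := by
    intro m; unfold DG.hprev; split_ifs <;> rfl
  set J : ℕ → ℝ := fun n => DG.jmp q N x w (if n + 1 = N then 0 else n + 1) with hJ
  have hseg : ∀ m < N, 0 < DG.hseg x m := fun m hm => sub_pos.mpr (hlt m hm)
  have step1 : DG.dGsq q N x w ≤ ∑ n ∈ Finset.range N,
      ((∫ y in (x n)..(x (n + 1)), (DG.pev' q w n y) ^ 2) + 2 * (J n)^2 / (x (n+1) - x n)) := by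
    unfold DG.dGsq
    rw [Finset.sum_add_distrib, Finset.sum_add_distrib]
    have := reindex N hN1 (fun m n => 2 * (DG.jmp q N x w m)^2 / DG.hseg x n)
    have e : ∑ n ∈ Finset.range N, 2 * (J n)^2 / (x (n+1) - x n) =
      ∑ m ∈ Finset.range N, 2 * (DG.jmp q N x w m)^2 / DG.hseg x (if m = 0 then N - 1 else m - 1) := this.symm
    rw [e]
    refine add_le_add le_rfl (Finset.sum_le_sum fun m hm => ?_)
    have hm' := Finset.mem_range.mp hm
    have p1 := hseg m hm'
    have p2 : 0 < DG.hseg x (if m = 0 then N - 1 else m - 1) := by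
      apply hseg; split_ifs <;> omega
    rw [hprev]
    apply div_le_div_of_nonneg_left (by positivity) p2 (by linarith)
  refine step1.trans ?_
  unfold DG.nsq DG.inner2
  rw [Finset.mul_sum]
  apply Finset.sum_le_sum
  intro n hn
  have hn' := Finset.mem_range.mp hn
  simp only [DG.pev_eq, DG.pev'_eq]
  apply h _ _ (hlt n hn')
  · have h1 := Polynomial.natDegree_derivative_le (DG.toP q w n)
    have := DG.toP_deg q w n
    omega
  intro p hp
  set Ψ : ℕ → ℕ → ℝ := fun m k => if m = n then p.coeff k else 0 with hΨ
  have hpΨ : ∀ m y, DG.pev q Ψ m y = if m = n then p.eval y else 0 := by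
    intro m y
    unfold DG.pev
    split_ifs with hm
    · rw [Polynomial.eval_eq_sum_range' (Nat.lt_succ_of_le hp)]
      simp [hΨ, hm]
    · simp [hΨ, hm]
  have key := hG Ψ
  unfold DG.inner2 DG.Bm at key
  have e3 : ∑ m ∈ Finset.range N, DG.jmp q N x w m * DG.valL q N x Ψ m =
      J n * p.eval (x (n+1)) := by
    have := reindex N hN1 (fun m k => DG.jmp q N x w m * DG.pev q Ψ k (x (k+1)))
    simp only [hvalL]
    rw [this, Finset.sum_eq_single_of_mem n hn]
    · simp [hpΨ, hJ]
    · intro m _ hm; simp [hpΨ, hm]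
  rw [e3, Finset.sum_eq_single_of_mem n hn, Finset.sum_eq_single_of_mem n hn] at key
  · simpa only [hpΨ, if_true, DG.pev_eq q Gm, DG.pev'_eq q w] using key
  · intro m _ hm; simp [hpΨ, hm]
  · intro m _ hm; simp [hpΨ, hm]
end

section
/- With the dG setup below, for every w ∈ C^{q+1}([0,1]) the interpolants S_q⁺[w] and S_q⁻[w] exist and are uniquely determined, and there is a constant C > 0 depending only on q (and not on the partition) such that ‖S_q⁺[w] − w‖_{L²(0,1)} ≤ C h^{q+1} ‖w‖_{C^{q+1}([0,1])} and ‖S_q⁻[w] − w‖_{L²(0,1)} ≤ C h^{q+1} ‖w‖_{C^{q+1}([0,1])}, where ‖w‖_{C^{q+1}} := max_{0 ≤ k ≤ q+1} sup_{x ∈ [0,1]} |w^{(k)}(x)|. -/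
open scoped BigOperators
open MeasureTheory Set

namespace DG

/-- The interpolation operator S_q⁺: on each cell I_n, p matches w at the left
endpoint x_n and has the same moments as w against all polynomials of degree
≤ q−1 (represented by their coefficients d). -/
def IsSqPlus (q N : ℕ) (x : ℕ → ℝ) (w : ℝ → ℝ) (p : ℕ → ℕ → ℝ) : Prop :=
  ∀ n < N, pev q p n (x n) = w (x n) ∧
    ∀ d : ℕ → ℝ,
      (∫ y in (x n)..(x (n + 1)),
        (pev q p n y - w y) * (∑ k ∈ Finset.range q, d k * y ^ k)) = 0

/-- The interpolation operator S_q⁻: as S_q⁺ but matching w at the right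
endpoint x_{n+1}. -/
def IsSqMinus (q N : ℕ) (x : ℕ → ℝ) (w : ℝ → ℝ) (p : ℕ → ℕ → ℝ) : Prop :=
  ∀ n < N, pev q p n (x (n + 1)) = w (x (n + 1)) ∧
    ∀ d : ℕ → ℝ,
      (∫ y in (x n)..(x (n + 1)),
        (pev q p n y - w y) * (∑ k ∈ Finset.range q, d k * y ^ k)) = 0

end DG

lemma rolle_fin (a b : ℝ) (F f : ℝ → ℝ) (hc : ContinuousOn F (Icc a b))
    (hd : ∀ y ∈ Ioo a b, HasDerivAt F (f y) y) (n : ℕ) (s : Finset ℝ) (hs : s.card = n + 1)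
    (hz : ∀ y ∈ s, y ∈ Icc a b ∧ F y = 0) :
    ∃ t : Finset ℝ, t.card = n ∧ ∀ y ∈ t, y ∈ Ioo a b ∧ f y = 0 := by
  let z := s.orderEmbOfFin hs
  have hzm : ∀ i, z i ∈ Icc a b ∧ F (z i) = 0 := fun i => hz _ (s.orderEmbOfFin_mem hs i)
  have key : ∀ i : Fin n, ∃ c ∈ Ioo (z i.castSucc) (z i.succ), f c = 0 := by
    intro i
    have hlt : z i.castSucc < z i.succ := z.strictMono Fin.castSucc_lt_succ
    refine exists_hasDerivAt_eq_zero hlt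
      (hc.mono (Icc_subset_Icc (hzm _).1.1 (hzm _).1.2)) ?_ ?_
    · rw [(hzm _).2, (hzm _).2]
    · intro y hy
      exact hd y ⟨(hzm _).1.1.trans_lt hy.1, hy.2.trans_le (hzm _).1.2⟩
  choose c hc1 hc2 using key
  have hmono : StrictMono c := by
    intro i j hij
    have h1 : z i.succ ≤ z j.castSucc := z.monotone (by
      rw [Fin.le_def]; simp; exact hij)
    exact (hc1 i).2.trans_le (h1.trans (hc1 j).1.le)
  refine ⟨Finset.univ.image c, ?_, ?_⟩
  · rw [Finset.card_image_of_injective _ hmono.injective]; simp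
  · intro y hy
    obtain ⟨i, -, rfl⟩ := Finset.mem_image.1 hy
    exact ⟨⟨(hzm _).1.1.trans_lt (hc1 i).1, (hc1 i).2.trans_le (hzm _).1.2⟩, hc2 i⟩

lemma orth_zeros (a b : ℝ) (hab : a < b) (m : ℕ) : ∀ f : ℝ → ℝ, Continuous f →
    (∀ k < m, ∫ y in a..b, f y * y ^ k = 0) →
    ∃ t : Finset ℝ, t.card = m ∧ ∀ y ∈ t, y ∈ Ioo a b ∧ f y = 0 := by
  induction m with
  | zero => intro f _ _; exact ⟨∅, by simp⟩
  | succ m ih =>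
    intro f hf ho
    set F : ℝ → ℝ := fun x => ∫ y in a..x, f y with hF
    have hFd : ∀ x, HasDerivAt F (f x) x := fun x => hf.integral_hasStrictDerivAt a x |>.hasDerivAt
    have hFc : Continuous F := continuous_iff_continuousAt.2 fun x => (hFd x).continuousAt
    have hFa : F a = 0 := by simp [hF]
    have hFb : F b = 0 := by simpa [hF] using ho 0 (by omega)
    obtain ⟨t, ht, htz⟩ := ih F hFc (by
      intro k hk
      have hp := intervalIntegral.integral_mul_deriv_eq_deriv_mul (a := a) (b := b)
        (u := F) (v := fun y => y ^ (k+1)) (u' := f) (v' := fun y => ((k+1 : ℕ):ℝ) * y ^ k)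
        (fun x _ => hFd x) (fun x _ => by simpa using hasDerivAt_pow (k+1) x)
        (hf.intervalIntegrable _ _) ((by fun_prop : Continuous fun y : ℝ => ((k+1 : ℕ):ℝ) * y ^ k).intervalIntegrable _ _)
      rw [hFa, hFb, ho (k+1) (by omega)] at hp
      have h2 : (∫ y in a..b, F y * (((k+1 : ℕ):ℝ) * y ^ k)) = ((k+1 : ℕ):ℝ) * ∫ y in a..b, F y * y ^ k := by
        rw [← intervalIntegral.integral_const_mul]
        congr 1; ext y; ring
      rw [h2] at hp
      have h3 : ((k+1 : ℕ):ℝ) ≠ 0 := by positivity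
      simpa [h3, -Nat.cast_add, -Nat.cast_succ] using hp)
    have hbt : b ∉ t := fun h => lt_irrefl _ (htz b h).1.2
    have hat : a ∉ insert b t := by
      intro h
      rcases Finset.mem_insert.1 h with h | h
      · exact hab.ne h
      · exact lt_irrefl _ (htz a h).1.1
    refine rolle_fin a b F f hFc.continuousOn (fun y _ => hFd y) (m+1) (insert a (insert b t)) ?_ ?_
    · rw [Finset.card_insert_of_notMem hat, Finset.card_insert_of_notMem hbt, ht]
    · intro y hy
      rcases Finset.mem_insert.1 hy with rfl | hy
      · exact ⟨⟨le_rfl, hab.le⟩, hFa⟩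
      rcases Finset.mem_insert.1 hy with rfl | hy
      · exact ⟨⟨hab.le, le_rfl⟩, hFb⟩
      · exact ⟨Ioo_subset_Icc_self (htz y hy).1, (htz y hy).2⟩

lemma orth_zeros' (a b : ℝ) (hab : a < b) (m : ℕ) (f : ℝ → ℝ) (hf : ContinuousOn f (Icc a b))
    (ho : ∀ k < m, ∫ y in a..b, f y * y ^ k = 0) :
    ∃ t : Finset ℝ, t.card = m ∧ ∀ y ∈ t, y ∈ Ioo a b ∧ f y = 0 := by
  let g := IccExtend hab.le (domRestrict (Icc a b) f)
  have hg : ∀ y ∈ Icc a b, g y = f y := fun y hy => by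
    simp only [g, IccExtend_of_mem hab.le _ hy]; rfl
  have hgc : Continuous g := (continuousOn_iff_continuous_domRestrict.1 hf).Icc_extend'
  obtain ⟨t, ht, h⟩ := orth_zeros a b hab m g hgc (by
    intro k hk
    rw [← ho k hk]
    apply intervalIntegral.integral_congr
    intro y hy
    rw [uIcc_of_le hab.le] at hy
    simp only [hg y hy])
  exact ⟨t, ht, fun y hy => ⟨(h y hy).1, by rw [← hg y (Ioo_subset_Icc_self (h y hy).1)]; exact (h y hy).2⟩⟩

lemma tower_bound (a b : ℝ) (q : ℕ) (M : ℝ) : ∀ (U : ℕ → ℝ → ℝ),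
    (∀ j ≤ q, ContinuousOn (U j) (Icc a b)) →
    (∀ j ≤ q, ∀ y ∈ Ioo a b, HasDerivAt (U j) (U (j+1) y) y) →
    (∀ y ∈ Icc a b, |U (q+1) y| ≤ M) →
    (∃ s : Finset ℝ, s.card = q + 1 ∧ ∀ y ∈ s, y ∈ Icc a b ∧ U 0 y = 0) →
    ∀ y ∈ Icc a b, |U 0 y| ≤ M * (b - a) ^ (q+1) := by
  have step : ∀ (F f : ℝ → ℝ) (K : ℝ), ContinuousOn F (Icc a b) →
      (∀ y ∈ Ioo a b, HasDerivAt F (f y) y) → (∀ y ∈ Icc a b, |f y| ≤ K) →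
      (∃ z ∈ Icc a b, F z = 0) → ∀ y ∈ Icc a b, |F y| ≤ K * (b - a) := by
    rintro F f K hc hd hb ⟨z, hz, hFz⟩ y hy
    have hK : 0 ≤ K := (abs_nonneg _).trans (hb y hy)
    have main : ∀ u ∈ Icc a b, ∀ v ∈ Icc a b, u < v → |F v - F u| ≤ K * (b - a) := by
      intro u hu v hv huv
      obtain ⟨c, hc1, hc2⟩ := exists_hasDerivAt_eq_slope F f huv
        (hc.mono (Icc_subset_Icc hu.1 hv.2))
        (fun y hy => hd y ⟨hu.1.trans_lt hy.1, hy.2.trans_le hv.2⟩)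
      have h0 : 0 < v - u := by linarith
      have : F v - F u = f c * (v - u) := by rw [hc2]; field_simp
      rw [this, abs_mul, abs_of_pos h0]
      have := hb c ⟨hu.1.trans hc1.1.le, hc1.2.le.trans hv.2⟩
      have h5 : v - u ≤ b - a := by linarith [hu.1, hv.2]
      gcongr
    rcases lt_trichotomy y z with h | h | h
    · have := main y hy z hz h
      rwa [hFz, zero_sub, abs_neg] at this
    · rw [h, hFz, abs_zero]; exact mul_nonneg hK (by linarith [hy.1, hy.2])
    · have := main z hz y hy h
      rwa [hFz, sub_zero] at this
  induction q with
  | zero =>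
    intro U hc hd hb ⟨s, hs, hz⟩ y hy
    have hne : s.Nonempty := Finset.card_pos.1 (by omega)
    obtain ⟨z, hzs⟩ := hne
    simpa using step (U 0) (U 1) M (hc 0 le_rfl) (hd 0 le_rfl) hb ⟨z, hz z hzs⟩ y hy
  | succ q ih =>
    intro U hc hd hb ⟨s, hs, hz⟩ y hy
    obtain ⟨t, ht, htz⟩ := rolle_fin a b (U 0) (U 1) (hc 0 (by omega)) (hd 0 (by omega)) _ s hs hz
    have h1 := ih (fun j => U (j+1)) (fun j hj => hc (j+1) (by omega))
      (fun j hj => hd (j+1) (by omega)) hb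
      ⟨t, ht, fun y hy => ⟨Ioo_subset_Icc_self (htz y hy).1, (htz y hy).2⟩⟩
    have hne : s.Nonempty := Finset.card_pos.1 (by omega)
    obtain ⟨z, hzs⟩ := hne
    have := step (U 0) (U 1) _ (hc 0 (by omega)) (hd 0 (by omega)) h1 ⟨z, hz z hzs⟩ y hy
    rw [pow_succ _ (q+1), ← mul_assoc]; exact this

/-- zeros of the interpolation error -/
lemma err_zeros (a b e : ℝ) (hab : a < b) (he : e = a ∨ e = b) (q : ℕ) (u : ℝ → ℝ)
    (hu : ContinuousOn u (Icc a b)) (h0 : u e = 0)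
    (ho : ∀ k < q, ∫ y in a..b, u y * y ^ k = 0) :
    ∃ s : Finset ℝ, s.card = q + 1 ∧ ∀ y ∈ s, y ∈ Icc a b ∧ u y = 0 := by
  obtain ⟨t, ht, htz⟩ := orth_zeros' a b hab q u hu ho
  have het : e ∉ t := by
    intro h
    have := (htz e h).1
    rcases he with rfl | rfl
    · exact lt_irrefl _ this.1
    · exact lt_irrefl _ this.2
  refine ⟨insert e t, by rw [Finset.card_insert_of_notMem het, ht], ?_⟩
  intro y hy
  rcases Finset.mem_insert.1 hy with rfl | hy
  · refine ⟨?_, h0⟩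
    rcases he with rfl | rfl
    · exact ⟨le_rfl, hab.le⟩
    · exact ⟨hab.le, le_rfl⟩
  · exact ⟨Ioo_subset_Icc_self (htz y hy).1, (htz y hy).2⟩

noncomputable def cpoly (q : ℕ) (c : ℕ → ℝ) : Polynomial ℝ :=
  ∑ k ∈ Finset.range (q + 1), Polynomial.monomial k (c k)

lemma cpoly_eval (q : ℕ) (c : ℕ → ℝ) (y : ℝ) :
    (cpoly q c).eval y = ∑ k ∈ Finset.range (q + 1), c k * y ^ k := by
  simp [cpoly, Polynomial.eval_finset_sum]

lemma cpoly_deg (q : ℕ) (c : ℕ → ℝ) : (cpoly q c).natDegree ≤ q := by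
  refine Polynomial.natDegree_sum_le_of_forall_le _ _ ?_
  intro k hk
  exact (Polynomial.natDegree_monomial_le _).trans (by simp at hk; omega)

lemma cpoly_coeff (q : ℕ) (c : ℕ → ℝ) (k : ℕ) (hk : k ≤ q) : (cpoly q c).coeff k = c k := by
  simp [cpoly, Polynomial.finset_sum_coeff, Polynomial.coeff_monomial]
  omega

/-- cell conditions -/
def CellI (q : ℕ) (a b e : ℝ) (w : ℝ → ℝ) (c : ℕ → ℝ) : Prop :=
  (cpoly q c).eval e = w e ∧ ∀ k < q, ∫ y in a..b, ((cpoly q c).eval y - w y) * y ^ k = 0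

lemma poly_zero (a b e : ℝ) (hab : a < b) (he : e = a ∨ e = b) (q : ℕ) (P : Polynomial ℝ)
    (hP : P.natDegree ≤ q) (h0 : P.eval e = 0)
    (ho : ∀ k < q, ∫ y in a..b, P.eval y * y ^ k = 0) : P = 0 := by
  obtain ⟨s, hs, hz⟩ := err_zeros a b e hab he q (fun y => P.eval y) P.continuous.continuousOn h0 ho
  exact Polynomial.eq_zero_of_natDegree_lt_card_of_eval_eq_zero' P s (fun y hy => (hz y hy).2) (by omega)

lemma cell_unique (a b e : ℝ) (hab : a < b) (he : e = a ∨ e = b) (q : ℕ) (w : ℝ → ℝ)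
    (hw : ContinuousOn w (Icc a b)) (c c' : ℕ → ℝ) (h : CellI q a b e w c)
    (h' : CellI q a b e w c') : cpoly q c = cpoly q c' := by
  have ii : ∀ (P : Polynomial ℝ) (k : ℕ), IntervalIntegrable (fun y => (P.eval y - w y) * y ^ k) volume a b := by
    intro P k
    apply ContinuousOn.intervalIntegrable
    rw [uIcc_of_le hab.le]
    exact (P.continuous.continuousOn.sub hw).mul (by fun_prop)
  refine sub_eq_zero.1 (poly_zero a b e hab he q _
    ((Polynomial.natDegree_sub_le _ _).trans (max_le (cpoly_deg _ _) (cpoly_deg _ _))) ?_ ?_)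
  · rw [Polynomial.eval_sub, h.1, h'.1, sub_self]
  · intro k hk
    rw [← sub_self (0:ℝ)]
    nth_rewrite 1 [← h.2 k hk]
    rw [← h'.2 k hk, ← intervalIntegral.integral_sub (ii _ _) (ii _ _)]
    congr 1; ext y; rw [Polynomial.eval_sub]; ring

lemma cell_exists (a b e : ℝ) (hab : a < b) (he : e = a ∨ e = b) (q : ℕ) (w : ℝ → ℝ)
    (hw : ContinuousOn w (Icc a b)) : ∃ c, CellI q a b e w c := by
  let ext : (Fin (q+1) → ℝ) → ℕ → ℝ := fun v k => if h : k < q + 1 then v ⟨k, h⟩ else 0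
  have hext : ∀ v y, (cpoly q (ext v)).eval y = ∑ i : Fin (q+1), v i * y ^ (i:ℕ) := by
    intro v y
    rw [cpoly_eval, Finset.sum_range]
    apply Finset.sum_congr rfl
    intro i _
    simp only [ext, dif_pos i.2]
  have ii : ∀ (P : Polynomial ℝ) (k : ℕ), IntervalIntegrable (fun y => P.eval y * y ^ k) volume a b := by
    intro P k
    exact (by fun_prop : Continuous (fun y => P.eval y * y ^ k)).intervalIntegrable _ _
  let L : (Fin (q+1) → ℝ) →ₗ[ℝ] (Fin (q+1) → ℝ) :=
    { toFun := fun v i => if (i:ℕ) = q then (cpoly q (ext v)).eval e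
        else ∫ y in a..b, (cpoly q (ext v)).eval y * y ^ (i:ℕ)
      map_add' := by
        intro v v'
        have h1 : ∀ y, (cpoly q (ext (v + v'))).eval y = (cpoly q (ext v)).eval y + (cpoly q (ext v')).eval y := by
          intro y
          simp only [hext, Pi.add_apply, add_mul, Finset.sum_add_distrib]
        funext i
        simp only [Pi.add_apply]
        split_ifs with hi
        · exact h1 e
        · rw [← intervalIntegral.integral_add (ii _ _) (ii _ _)]
          congr 1; funext y; rw [h1]; ring
      map_smul' := by
        intro r v
        have h1 : ∀ y, (cpoly q (ext (r • v))).eval y = r * (cpoly q (ext v)).eval y := by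
          intro y
          simp only [hext, Pi.smul_apply, smul_eq_mul, Finset.mul_sum, mul_assoc]
        funext i
        simp only [Pi.smul_apply, smul_eq_mul, RingHom.id_apply]
        split_ifs with hi
        · exact h1 e
        · rw [← intervalIntegral.integral_const_mul]
          congr 1; funext y; rw [h1]; ring }
  have hL : ∀ v i, L v i = if (i:ℕ) = q then (cpoly q (ext v)).eval e
        else ∫ y in a..b, (cpoly q (ext v)).eval y * y ^ (i:ℕ) := fun _ _ => rfl
  have hinj : Function.Injective L := by
    rw [← LinearMap.ker_eq_bot, LinearMap.ker_eq_bot']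
    intro v hv
    have hP : cpoly q (ext v) = 0 := by
      refine poly_zero a b e hab he q _ (cpoly_deg _ _) ?_ ?_
      · have := congrFun hv ⟨q, by omega⟩
        simpa [hL] using this
      · intro k hk
        have := congrFun hv ⟨k, by omega⟩
        simpa [hL, hk.ne] using this
    funext i
    have := cpoly_coeff q (ext v) i (by omega)
    rw [hP] at this
    simp only [ext, dif_pos i.2, Polynomial.coeff_zero] at this
    exact this.symm
  obtain ⟨v, hv⟩ := (LinearMap.injective_iff_surjective.1 hinj)
    (fun i => if (i:ℕ) = q then w e else ∫ y in a..b, w y * y ^ (i:ℕ))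
  refine ⟨ext v, ?_, ?_⟩
  · have := congrFun hv ⟨q, by omega⟩
    simpa [hL] using this
  · intro k hk
    have h1 := congrFun hv ⟨k, by omega⟩
    simp only [hL, hk.ne, if_false] at h1
    have iw : IntervalIntegrable (fun y => w y * y ^ k) volume a b := by
      apply ContinuousOn.intervalIntegrable
      rw [uIcc_of_le hab.le]
      exact hw.mul (by fun_prop)
    simp only [sub_mul]
    rw [intervalIntegral.integral_sub (ii _ _) iw, h1, sub_self]

lemma cell_bound (a b e : ℝ) (hab : a < b) (ha : 0 ≤ a) (hb : b ≤ 1) (he : e = a ∨ e = b) (q : ℕ)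
    (w : ℝ → ℝ) (hw : ContDiffOn ℝ (q + 1) w (Icc 0 1)) (M : ℝ)
    (hM : ∀ y ∈ Icc (0 : ℝ) 1, |iteratedDerivWithin (q+1) w (Icc (0 : ℝ) 1) y| ≤ M)
    (c : ℕ → ℝ) (h : CellI q a b e w c) :
    ∀ y ∈ Icc a b, |(cpoly q c).eval y - w y| ≤ M * (b - a) ^ (q+1) := by
  have hsub : Icc a b ⊆ Icc 0 1 := Icc_subset_Icc ha hb
  have hud : UniqueDiffOn ℝ (Icc (0:ℝ) 1) := uniqueDiffOn_Icc zero_lt_one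
  let U : ℕ → ℝ → ℝ := fun j y => (Polynomial.derivative^[j] (cpoly q c)).eval y
    - iteratedDerivWithin j w (Icc 0 1) y
  have hU0 : ∀ y, U 0 y = (cpoly q c).eval y - w y := fun y => by simp [U]
  have := tower_bound a b q M U ?_ ?_ ?_ ?_
  · simpa only [hU0] using this
  · intro j hj
    refine (Polynomial.continuous _).continuousOn.sub
      ((hw.continuousOn_iteratedDerivWithin ?_ hud).mono hsub)
    exact_mod_cast (by omega : j ≤ q + 1)
  · intro j hj y hy
    have hy1 : Icc (0:ℝ) 1 ∈ nhds y := Icc_mem_nhds (ha.trans_lt hy.1) (hy.2.trans_le hb)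
    have hd := hw.differentiableOn_iteratedDerivWithin (m := j) (by exact_mod_cast (by omega : j < q + 1)) hud
    have h2 := ((hd y (hsub (Ioo_subset_Icc_self hy))).hasDerivWithinAt).hasDerivAt hy1
    rw [← iteratedDerivWithin_succ] at h2
    have h3 := (Polynomial.derivative^[j] (cpoly q c)).hasDerivAt y
    rw [← Function.iterate_succ_apply' (f := Polynomial.derivative)] at h3
    exact h3.sub h2
  · intro y hy
    have h0 : Polynomial.derivative^[q+1] (cpoly q c) = 0 :=
      Polynomial.iterate_derivative_eq_zero (by have := cpoly_deg q c; omega)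
    simp only [U, h0, Polynomial.eval_zero, zero_sub, abs_neg]
    exact hM y (hsub hy)
  · simp only [hU0]
    exact err_zeros a b e hab he q _
      ((Polynomial.continuous _).continuousOn.sub (hw.continuousOn.mono hsub))
      (by rw [h.1, sub_self]) h.2

lemma cell_iff (q : ℕ) (a b e : ℝ) (hab : a < b) (w : ℝ → ℝ) (hw : ContinuousOn w (Icc a b))
    (p : ℕ → ℕ → ℝ) (n : ℕ) :
    (DG.pev q p n e = w e ∧ ∀ d : ℕ → ℝ,
      (∫ y in a..b, (DG.pev q p n y - w y) * (∑ k ∈ Finset.range q, d k * y ^ k)) = 0) ↔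
    CellI q a b e w (p n) := by
  have hp : ∀ y, DG.pev q p n y = (cpoly q (p n)).eval y := fun y => (cpoly_eval _ _ _).symm
  simp only [hp, CellI]
  refine and_congr_right fun _ => ⟨fun h k hk => ?_, fun h d => ?_⟩
  · rw [← h (fun j => if j = k then 1 else 0)]
    congr 1; funext y
    simp [hk]
  · simp only [Finset.mul_sum]
    rw [intervalIntegral.integral_finsetSum]
    · apply Finset.sum_eq_zero
      intro k hk
      rw [← mul_zero (d k), ← h k (Finset.mem_range.1 hk), ← intervalIntegral.integral_const_mul]
      congr 1; funext y; ring
    · intro k hk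
      apply ContinuousOn.intervalIntegrable
      rw [uIcc_of_le hab.le]
      exact ((Polynomial.continuous _).continuousOn.sub hw).mul (by fun_prop)

lemma part_mem (N : ℕ) (x : ℕ → ℝ) (hx : DG.Partition N x) : ∀ n ≤ N, 0 ≤ x n ∧ x n ≤ 1 := by
  obtain ⟨_, h0, h1, hl⟩ := hx
  have mono : ∀ m n, m ≤ n → n ≤ N → x m ≤ x n := by
    intro m n hmn
    induction n, hmn using Nat.le_induction with
    | base => intro _; exact le_rfl
    | succ n _ ih => intro h; exact (ih (by omega)).trans (hl n (by omega)).le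
  intro n hn
  exact ⟨h0 ▸ mono 0 n (by omega) hn, h1 ▸ mono n N hn le_rfl⟩

lemma main_gen (q N : ℕ) (x : ℕ → ℝ) (hx : DG.Partition N x) (h : ℝ)
    (hh : ∀ n < N, DG.hseg x n ≤ h) (w : ℝ → ℝ) (hw : ContDiffOn ℝ (q + 1) w (Icc 0 1)) (M : ℝ)
    (hM : ∀ y ∈ Icc (0 : ℝ) 1, |iteratedDerivWithin (q+1) w (Icc (0 : ℝ) 1) y| ≤ M)
    (e : ℕ → ℝ) (he : ∀ n, e n = x n ∨ e n = x (n+1)) (Q : (ℕ → ℕ → ℝ) → Prop)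
    (hQ : ∀ p, Q p ↔ ∀ n < N, (DG.pev q p n (e n) = w (e n) ∧ ∀ d : ℕ → ℝ,
      (∫ y in (x n)..(x (n+1)), (DG.pev q p n y - w y) * (∑ k ∈ Finset.range q, d k * y ^ k)) = 0)) :
    (∃ p, Q p) ∧ (∀ p p', Q p → Q p' → ∀ n < N, ∀ y : ℝ, DG.pev q p n y = DG.pev q p' n y) ∧
    (∀ p, Q p → (∑ n ∈ Finset.range N,
            ∫ y in (x n)..(x (n + 1)), (DG.pev q p n y - w y) ^ 2)
            ≤ 1 * h ^ (2 * (q + 1)) * M ^ 2) := by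
  have hmem := part_mem N x hx
  obtain ⟨_, hx0, hx1, hl⟩ := hx
  have hwn : ∀ n < N, ContinuousOn w (Icc (x n) (x (n+1))) := fun n hn =>
    hw.continuousOn.mono (Icc_subset_Icc (hmem n hn.le).1 (hmem (n+1) hn).2)
  have hQ' : ∀ p, Q p ↔ ∀ n < N, CellI q (x n) (x (n+1)) (e n) w (p n) := by
    intro p
    rw [hQ]
    exact forall_congr' fun n => forall_congr' fun hn => cell_iff q _ _ _ (hl n hn) w (hwn n hn) p n
  have hp : ∀ p n y, DG.pev q p n y = (cpoly q (p n)).eval y := fun p n y => (cpoly_eval _ _ _).symm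
  refine ⟨?_, ?_, ?_⟩
  · have : ∀ n, ∃ c, n < N → CellI q (x n) (x (n+1)) (e n) w c := by
      intro n
      by_cases hn : n < N
      · obtain ⟨c, hc⟩ := cell_exists _ _ _ (hl n hn) (he n) q w (hwn n hn)
        exact ⟨c, fun _ => hc⟩
      · exact ⟨0, fun h => absurd h hn⟩
    choose p hp using this
    exact ⟨p, (hQ' p).2 hp⟩
  · intro p p' h1 h2 n hn y
    rw [hp, hp, cell_unique _ _ _ (hl n hn) (he n) q w (hwn n hn) _ _ ((hQ' p).1 h1 n hn)
      ((hQ' p').1 h2 n hn)]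
  · intro p h1
    have hM0 : 0 ≤ M := (abs_nonneg _).trans (hM 0 (by simp))
    calc _ ≤ ∑ n ∈ Finset.range N, (x (n+1) - x n) * (h ^ (2 * (q+1)) * M^2) := by
          apply Finset.sum_le_sum
          intro n hn
          rw [Finset.mem_range] at hn
          have hb := cell_bound _ _ _ (hl n hn) (hmem n hn.le).1 (hmem (n+1) hn).2 (he n) q w hw M hM
            _ ((hQ' p).1 h1 n hn)
          have hd : x (n+1) - x n ≤ h := hh n hn
          have hd0 : 0 ≤ x (n+1) - x n := by linarith [hl n hn]
          rw [← smul_eq_mul, ← intervalIntegral.integral_const]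
          apply intervalIntegral.integral_mono_on (hl n hn).le
          · apply ContinuousOn.intervalIntegrable
            rw [uIcc_of_le (hl n hn).le]
            simp only [hp]
            exact ((Polynomial.continuous _).continuousOn.sub (hwn n hn)).pow 2
          · exact intervalIntegrable_const
          · intro y hy
            have h4 : |DG.pev q p n y - w y| ≤ M * h ^ (q+1) := by
              rw [hp]
              refine (hb y hy).trans ?_
              gcongr
            rw [← sq_abs]
            calc _ ≤ (M * h ^ (q+1))^2 := by gcongr
              _ = _ := by ring
      _ = _ := by
          rw [← Finset.sum_mul, Finset.sum_range_sub, hx0, hx1]; ring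

/-- Existence, uniqueness and approximation properties of the
interpolants S_q⁺ and S_q⁻, first estimate of Lemma "Properties of the
projection operator Q": for w ∈ C^{q+1}([0,1]) the interpolants exist, are
unique (as piecewise polynomials on the cells), and satisfy
‖S_q^±[w] − w‖_{L²(0,1)} ≤ C h^{q+1} ‖w‖_{C^{q+1}([0,1])}, with C depending
only on q.  Stated with squared L² norms, with h any upper bound for the cell
sizes and M any upper bound for the C^{q+1} norm. -/
theorem stmt_11 (q : ℕ) (hq : 1 ≤ q) :
    ∃ C > (0 : ℝ), ∀ (N : ℕ) (x : ℕ → ℝ), DG.Partition N x →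
      ∀ h : ℝ, (∀ n < N, DG.hseg x n ≤ h) →
      ∀ w : ℝ → ℝ, ContDiffOn ℝ (q + 1) w (Set.Icc 0 1) →
      ∀ M : ℝ,
        (∀ k ≤ q + 1, ∀ y ∈ Set.Icc (0 : ℝ) 1,
          |iteratedDerivWithin k w (Set.Icc (0 : ℝ) 1) y| ≤ M) →
        (∃ p : ℕ → ℕ → ℝ, DG.IsSqPlus q N x w p) ∧
        (∃ p : ℕ → ℕ → ℝ, DG.IsSqMinus q N x w p) ∧
        (∀ p p' : ℕ → ℕ → ℝ, DG.IsSqPlus q N x w p → DG.IsSqPlus q N x w p' →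
          ∀ n < N, ∀ y : ℝ, DG.pev q p n y = DG.pev q p' n y) ∧
        (∀ p p' : ℕ → ℕ → ℝ, DG.IsSqMinus q N x w p → DG.IsSqMinus q N x w p' →
          ∀ n < N, ∀ y : ℝ, DG.pev q p n y = DG.pev q p' n y) ∧
        (∀ p : ℕ → ℕ → ℝ, DG.IsSqPlus q N x w p →
          (∑ n ∈ Finset.range N,
            ∫ y in (x n)..(x (n + 1)), (DG.pev q p n y - w y) ^ 2)
            ≤ C * h ^ (2 * (q + 1)) * M ^ 2) ∧
        (∀ p : ℕ → ℕ → ℝ, DG.IsSqMinus q N x w p →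
          (∑ n ∈ Finset.range N,
            ∫ y in (x n)..(x (n + 1)), (DG.pev q p n y - w y) ^ 2)
            ≤ C * h ^ (2 * (q + 1)) * M ^ 2) := by
  refine ⟨1, one_pos, ?_⟩
  intro N x hx h hh w hw M hM
  obtain ⟨a1, a2, a3⟩ := main_gen q N x hx h hh w hw M (hM (q+1) le_rfl) x (fun n => Or.inl rfl)
    (DG.IsSqPlus q N x w) (fun p => Iff.rfl)
  obtain ⟨b1, b2, b3⟩ := main_gen q N x hx h hh w hw M (hM (q+1) le_rfl) (fun n => x (n+1))
    (fun n => Or.inr rfl) (DG.IsSqMinus q N x w) (fun p => Iff.rfl)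
  exact ⟨a1, b1, a2, b2, a3, b3⟩
end
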